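/- Let d ≥ 2, 1 < p < ∞, C > 0 and R₀ > 0. Let V be a measurable function on { x ∈ ℝ^d : ‖x‖ > R₀ } with 0 ≤ V(x) and ‖x‖^p V(x) ≤ C for almost every x, and assume that for every bounded measurable function φ : ℝ^d → ℝ vanishing outside some annulus { x : a ≤ ‖x‖ ≤ b } with 0 < a < b < ∞, one has lim_{R → ∞} ∫ R^p V(Rx) φ(x) dx = 0 (the integral taken over those x with ‖Rx‖ > R₀). Let u be a positive C¹ weak solution of -Δ_p w + V|w|^{p-2}w = 0 in { x : ‖x‖ > R₀ }. Then lim_{‖x‖ → ∞} u(x) exists in the extended interval [0, +∞] (the limit might be infinite). -/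

import Mathlib

open MeasureTheory Metric Filter Topology Set
open scoped RealInnerProductSpace ENNReal

noncomputable section

/-- `u` is a positive `C¹` weak solution of `-Δ_p u + V|u|^{p-2}u = 0` in the open set `Ω`. -/
def IsPosWeakSol {d : ℕ} (p : ℝ) (V : EuclideanSpace ℝ (Fin d) → ℝ)
    (Ω : Set (EuclideanSpace ℝ (Fin d))) (u : EuclideanSpace ℝ (Fin d) → ℝ) : Prop :=
  ContDiffOn ℝ 1 u Ω ∧ (∀ x ∈ Ω, 0 < u x) ∧
  ∀ φ : EuclideanSpace ℝ (Fin d) → ℝ, ContDiff ℝ (⊤ : ℕ∞) φ → HasCompactSupport φ →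
    tsupport φ ⊆ Ω →
    ∫ x in Ω, (‖gradient u x‖ ^ (p - 2) * ⟪gradient u x, gradient φ x⟫ +
      V x * |u x| ^ (p - 2) * u x * φ x) = 0

set_option linter.unusedSectionVars false

section PLaplace

variable {E : Type*} [NormedAddCommGroup E] [InnerProductSpace ℝ E] [FiniteDimensional ℝ E]
  [MeasurableSpace E] [BorelSpace E]

/-- For `σ = 1` this says `-Δ_p w ≤ Λ w^{p-1}` weakly in `U`, and for `σ = -1` it says
`-Δ_p w ≥ -Λ w^{p-1}`; the test functions are `C¹` and nonnegative. -/
def HalfSol (μ : Measure E) (p σ Λ : ℝ) (U : Set E) (w : E → ℝ) : Prop :=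
  ∀ φ : E → ℝ, ContDiff ℝ 1 φ → HasCompactSupport φ → tsupport φ ⊆ U → (∀ x, 0 ≤ φ x) →
    σ * ∫ x, ‖gradient w x‖ ^ (p - 2) * ⟪gradient w x, gradient φ x⟫ ∂μ ≤
      Λ * ∫ x, w x ^ (p - 1) * φ x ∂μ

lemma continuous_flux {p : ℝ} (hp : 1 < p) :
    Continuous fun z : E × E => ‖z.1‖ ^ (p - 2) * ⟪z.1, z.2⟫ := by
  have h : Continuous fun z : E × E => fderiv ℝ (fun x : E => ‖x‖ ^ p) z.1 z.2 :=
    (((contDiff_norm_rpow hp).continuous_fderiv one_ne_zero).comp continuous_fst).clm_apply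
      continuous_snd
  convert h.const_smul (p⁻¹) using 2 with z
  change _ = p⁻¹ * fderiv ℝ (fun x : E => ‖x‖ ^ p) z.1 z.2
  rw [fderiv_norm_rpow _ hp]
  have : p ≠ 0 := by linarith
  simp
  field_simp

lemma norm_gradient (f : E → ℝ) (x : E) : ‖gradient f x‖ = ‖fderiv ℝ f x‖ := by
  simp [gradient]

lemma ContDiffOn.continuousOn_gradient {f : E → ℝ} {U : Set E} (hf : ContDiffOn ℝ 1 f U)
    (hU : IsOpen U) : ContinuousOn (gradient f) U :=
  (InnerProductSpace.toDual ℝ E).symm.continuous.comp_continuousOn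
    (hf.continuousOn_fderiv_of_isOpen hU le_rfl)

lemma ContDiff.continuous_gradient {f : E → ℝ} (hf : ContDiff ℝ 1 f) : Continuous (gradient f) :=
  (InnerProductSpace.toDual ℝ E).symm.continuous.comp (hf.continuous_fderiv one_ne_zero)

lemma gradient_of_notMem_tsupport {f : E → ℝ} {x : E} (hx : x ∉ tsupport f) :
    gradient f x = 0 := by
  have : fderiv ℝ f x = 0 := by
    by_contra h
    exact hx (support_fderiv_subset ℝ h)
  simp [gradient, this]

/-- The product of a cutoff supported in `U` with a `C¹` function on `U` is globally `C¹`. -/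
lemma contDiff_cutoff_mul {χ f : E → ℝ} {U : Set E} (hU : IsOpen U) (hχ : ContDiff ℝ 1 χ)
    (hs : tsupport χ ⊆ U) (hf : ContDiffOn ℝ 1 f U) : ContDiff ℝ 1 fun x => χ x * f x := by
  rw [contDiff_iff_contDiffAt]
  intro x
  by_cases hx : x ∈ U
  · exact hχ.contDiffAt.mul (hf.contDiffAt (hU.mem_nhds hx))
  · have h : χ =ᶠ[𝓝 x] 0 := notMem_tsupport_iff_eventuallyEq.mp fun h => hx (hs h)
    refine (contDiffAt_const (c := (0 : ℝ))).congr_of_eventuallyEq ?_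
    filter_upwards [h] with y hy
    simp [hy]

lemma gradient_cutoff_mul_rpow {χ w : E → ℝ} {x : E} (hχ : DifferentiableAt ℝ χ x)
    (hw : DifferentiableAt ℝ w x) (h0 : 0 < w x) (β : ℝ) :
    gradient (fun y => χ y * w y ^ β) x =
      (w x ^ β) • gradient χ x + (β * χ x * w x ^ (β - 1)) • gradient w x := by
  have h1 : HasFDerivAt (fun y => χ y * w y ^ β)
      (χ x • ((β * w x ^ (β - 1)) • fderiv ℝ w x) + (w x ^ β) • fderiv ℝ χ x) x :=
    hχ.hasFDerivAt.mul (hw.hasFDerivAt.rpow_const (Or.inl h0.ne'))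
  unfold gradient
  rw [h1.fderiv]
  simp only [map_add, map_smulₛₗ, smul_smul]
  simp
  rw [add_comm]
  congr 2
  ring

/-- Young's inequality in the form used for absorption. -/
lemma rpow_sub_one_mul_le {p z G ε : ℝ} (hp : 1 < p) (hz : 0 ≤ z) (hG : 0 ≤ G) (hε : 0 < ε) :
    z ^ (p - 1) * G ≤ ε * z ^ p + ε ^ (1 - p) * G ^ p := by
  rcases le_total G (ε * z) with h | h
  · have h1 : z ^ p = z ^ (p - 1) * z := by
      rw [← Real.rpow_add_one' hz (by linarith)]; ring_nf
    have : z ^ (p - 1) * G ≤ z ^ (p - 1) * (ε * z) := by gcongr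
    have : 0 ≤ ε ^ (1 - p) * G ^ p := by positivity
    rw [h1]; linarith
  · have h1 : z ≤ G / ε := by rw [le_div_iff₀ hε]; linarith
    have h2 : z ^ (p - 1) * G ≤ (G / ε) ^ (p - 1) * G := by gcongr
    have h3 : (G / ε) ^ (p - 1) * G = ε ^ (1 - p) * G ^ p := by
      have e1 : G ^ p = G ^ (p - 1) * G := by
        rw [← Real.rpow_add_one' hG (by linarith)]; ring_nf
      have e2 : ε ^ (1 - p) = (ε ^ (p - 1))⁻¹ := by
        rw [← Real.rpow_neg hε.le]; ring_nf
      rw [Real.div_rpow hG hε.le, e1, e2]; ring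
    have : 0 ≤ ε * z ^ p := by positivity
    linarith

end PLaplace

section Caccioppoli

variable {E : Type*} [NormedAddCommGroup E] [InnerProductSpace ℝ E] [FiniteDimensional ℝ E]
  [MeasurableSpace E] [BorelSpace E]

lemma caccioppoli_pointwise {p σ b W X G : ℝ} {ξ ζ : E} (hp : 1 < p) (hσ : σ ^ 2 = 1) (hb : 0 < b)
    (hW : 0 < W) (hX : 0 ≤ X) (hG : 0 ≤ G) (hζ : ‖ζ‖ ≤ G * X ^ ((p - 1) / p)) :
    b / 2 * (X * W ^ (σ * b + (p - 1)) * (‖ξ‖ / W) ^ p)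
        - (b / 2) ^ (1 - p) * G ^ p * W ^ (σ * b + (p - 1)) ≤
      σ * (‖ξ‖ ^ (p - 2) * ⟪ξ, (W ^ (σ * b)) • ζ + (σ * b * X * W ^ (σ * b - 1)) • ξ⟫) := by
  have hσ' : |σ| = 1 := by
    rw [← sq_abs] at hσ
    nlinarith [abs_nonneg σ]
  set z := ‖ξ‖ / W with hz
  have hz0 : 0 ≤ z := by positivity
  have hξ : ‖ξ‖ = W * z := by rw [hz]; field_simp
  set Q := W ^ (σ * b + (p - 1)) with hQ
  have hQ0 : 0 < Q := by positivity
  have e1 : ‖ξ‖ ^ (p - 2) * ‖ξ‖ ^ 2 = ‖ξ‖ ^ p := by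
    rw [← Real.rpow_natCast ‖ξ‖ 2, ← Real.rpow_add' (norm_nonneg _) (by norm_num; linarith)]
    norm_num
  have e2 : ‖ξ‖ ^ (p - 2) * ‖ξ‖ = ‖ξ‖ ^ (p - 1) := by
    rw [← Real.rpow_add_one' (norm_nonneg _) (by linarith)]
    ring_nf
  have e3 : W ^ (σ * b - 1) * ‖ξ‖ ^ p = Q * z ^ p := by
    rw [hξ, Real.mul_rpow hW.le hz0, ← mul_assoc, ← Real.rpow_add hW, hQ]
    ring_nf
  have e4 : W ^ (σ * b) * ‖ξ‖ ^ (p - 1) = Q * z ^ (p - 1) := by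
    rw [hξ, Real.mul_rpow hW.le hz0, ← mul_assoc, ← Real.rpow_add hW]
  have e5 : σ * (‖ξ‖ ^ (p - 2) * ⟪ξ, (W ^ (σ * b)) • ζ + (σ * b * X * W ^ (σ * b - 1)) • ξ⟫)
      = σ * W ^ (σ * b) * (‖ξ‖ ^ (p - 2) * ⟪ξ, ζ⟫) + b * (X * Q * z ^ p) := by
    rw [inner_add_right, real_inner_smul_right, real_inner_smul_right, real_inner_self_eq_norm_sq]
    have : σ * (‖ξ‖ ^ (p - 2) * (W ^ (σ * b) * ⟪ξ, ζ⟫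
        + σ * b * X * W ^ (σ * b - 1) * ‖ξ‖ ^ 2)) = σ * W ^ (σ * b) * (‖ξ‖ ^ (p - 2) * ⟪ξ, ζ⟫)
        + σ ^ 2 * b * X * (W ^ (σ * b - 1) * (‖ξ‖ ^ (p - 2) * ‖ξ‖ ^ 2)) := by ring
    rw [this, e1, e3, hσ]
    ring
  have hY : z ^ (p - 1) * X ^ ((p - 1) / p) = (z * X ^ (1 / p)) ^ (p - 1) := by
    rw [Real.mul_rpow hz0 (by positivity), ← Real.rpow_mul hX]
    ring_nf
  have hY2 : (z * X ^ (1 / p)) ^ p = X * z ^ p := by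
    rw [Real.mul_rpow hz0 (by positivity), ← Real.rpow_mul hX, one_div,
      inv_mul_cancel₀ (by linarith), Real.rpow_one, mul_comm]
  have young := rpow_sub_one_mul_le (z := z * X ^ (1 / p)) hp (by positivity) hG
    (half_pos hb)
  rw [← hY, hY2] at young
  have e6 : |σ * W ^ (σ * b) * (‖ξ‖ ^ (p - 2) * ⟪ξ, ζ⟫)| ≤ Q * (z ^ (p - 1) * X ^ ((p - 1) / p) * G) := by
    rw [abs_mul, abs_mul, abs_mul, hσ', one_mul, abs_of_pos (by positivity : 0 < W ^ (σ * b)),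
      abs_of_nonneg (by positivity : 0 ≤ ‖ξ‖ ^ (p - 2))]
    calc W ^ (σ * b) * (‖ξ‖ ^ (p - 2) * |⟪ξ, ζ⟫|)
        ≤ W ^ (σ * b) * (‖ξ‖ ^ (p - 2) * (‖ξ‖ * (G * X ^ ((p - 1) / p)))) := by
          gcongr
          exact (abs_real_inner_le_norm _ _).trans (by gcongr)
      _ = (W ^ (σ * b) * (‖ξ‖ ^ (p - 2) * ‖ξ‖)) * (G * X ^ ((p - 1) / p)) := by ring
      _ = _ := by rw [e2, e4]; ring
  have e7 : Q * (z ^ (p - 1) * X ^ ((p - 1) / p) * G)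
      ≤ Q * (b / 2 * (X * z ^ p) + (b / 2) ^ (1 - p) * G ^ p) := by gcongr
  rw [e5]
  have := neg_abs_le (σ * W ^ (σ * b) * (‖ξ‖ ^ (p - 2) * ⟪ξ, ζ⟫))
  nlinarith

/-- Caccioppoli's inequality for powers of positive half-solutions. -/
lemma HalfSol.caccioppoli {μ : Measure E} [IsFiniteMeasureOnCompacts μ] {p σ Λ b G : ℝ} {U : Set E}
    {w χ : E → ℝ} (h : HalfSol μ p σ Λ U w) (hp : 1 < p) (hU : IsOpen U)
    (hw : ContDiffOn ℝ 1 w U) (hpos : ∀ x ∈ U, 0 < w x) (hσ : σ ^ 2 = 1) (hb : 0 < b)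
    (hΛ : 0 ≤ Λ) (hχ : ContDiff ℝ 1 χ) (hc : HasCompactSupport χ) (hs : tsupport χ ⊆ U)
    (h0 : ∀ x, 0 ≤ χ x) (h1 : ∀ x, χ x ≤ 1) (hG : 0 ≤ G)
    (hχG : ∀ x, ‖gradient χ x‖ ≤ G * χ x ^ ((p - 1) / p)) :
    b / 2 * ∫ x in tsupport χ, χ x * w x ^ (σ * b + (p - 1)) * (‖gradient w x‖ / w x) ^ p ∂μ ≤
      ((b / 2) ^ (1 - p) * G ^ p + Λ) * ∫ x in tsupport χ, w x ^ (σ * b + (p - 1)) ∂μ := by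
  set S := tsupport χ with hS
  have hSc : IsCompact S := hc
  have hSm : MeasurableSet S := (isClosed_tsupport χ).measurableSet
  have hwS : ContinuousOn w S := hw.continuousOn.mono hs
  have hgS : ContinuousOn (gradient w) S := (hw.continuousOn_gradient hU).mono hs
  have hne : ∀ x ∈ S, w x ≠ 0 := fun x hx => (hpos x (hs hx)).ne'
  have hrS : ∀ r : ℝ, ContinuousOn (fun x => w x ^ r) S := fun r =>
    hwS.rpow_const fun x hx => Or.inl (hne x hx)
  set φ : E → ℝ := fun x => χ x * w x ^ (σ * b) with hφ
  have hφ1 : ContDiff ℝ 1 φ := contDiff_cutoff_mul hU hχ hs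
    (hw.rpow_const_of_ne fun x hx => (hpos x hx).ne')
  have hφS : tsupport φ ⊆ S := closure_mono fun x hx => by
    simp only [hφ, Function.mem_support] at hx ⊢
    exact left_ne_zero_of_mul hx
  have hφ0 : ∀ x, 0 ≤ φ x := fun x => by
    by_cases hx : x ∈ S
    · have := hpos x (hs hx)
      have := h0 x
      positivity
    · simp [hφ, image_eq_zero_of_notMem_tsupport hx]
  have key := h φ hφ1 (hc.of_isClosed_subset (isClosed_tsupport _) hφS) (hφS.trans hs) hφ0
  have k1 : ∫ x in S, ‖gradient w x‖ ^ (p - 2) * ⟪gradient w x, gradient φ x⟫ ∂μ =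
      ∫ x, ‖gradient w x‖ ^ (p - 2) * ⟪gradient w x, gradient φ x⟫ ∂μ :=
    setIntegral_eq_integral_of_forall_compl_eq_zero fun x hx => by
      rw [gradient_of_notMem_tsupport (fun h => hx (hφS h))]; simp
  have k2 : ∫ x in S, w x ^ (p - 1) * φ x ∂μ = ∫ x, w x ^ (p - 1) * φ x ∂μ :=
    setIntegral_eq_integral_of_forall_compl_eq_zero fun x hx => by
      rw [image_eq_zero_of_notMem_tsupport (fun h => hx (hφS h))]; simp
  rw [← k1, ← k2] at key
  have c1 : ContinuousOn (fun x => ‖gradient w x‖ ^ (p - 2) * ⟪gradient w x, gradient φ x⟫) S :=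
    (continuous_flux hp).comp_continuousOn (hgS.prodMk hφ1.continuous_gradient.continuousOn)
  have c2 : ContinuousOn (fun x => w x ^ (p - 1) * φ x) S :=
    (hrS _).mul hφ1.continuous.continuousOn
  have c3 : ContinuousOn
      (fun x => χ x * w x ^ (σ * b + (p - 1)) * (‖gradient w x‖ / w x) ^ p) S :=
    (hχ.continuous.continuousOn.mul (hrS _)).mul
      ((hgS.norm.div hwS hne).rpow_const fun x hx => Or.inr (by linarith))
  have i3 := c3.integrableOn_compact (μ := μ) hSc
  have i4 := (hrS (σ * b + (p - 1))).integrableOn_compact (μ := μ) hSc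
  have m1 : ∫ x in S, (b / 2 * (χ x * w x ^ (σ * b + (p - 1)) * (‖gradient w x‖ / w x) ^ p)
        - (b / 2) ^ (1 - p) * G ^ p * w x ^ (σ * b + (p - 1))) ∂μ ≤
      ∫ x in S, σ * (‖gradient w x‖ ^ (p - 2) * ⟪gradient w x, gradient φ x⟫) ∂μ := by
    refine setIntegral_mono_on ((i3.const_mul _).sub (i4.const_mul _))
      ((c1.integrableOn_compact hSc).const_mul _) hSm fun x hx => ?_
    rw [gradient_cutoff_mul_rpow (hχ.differentiable one_ne_zero x)
      ((hw.contDiffAt (hU.mem_nhds (hs hx))).differentiableAt one_ne_zero) (hpos x (hs hx))]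
    exact caccioppoli_pointwise hp hσ hb (hpos x (hs hx)) (h0 x) hG (hχG x)
  have m2 : ∫ x in S, w x ^ (p - 1) * φ x ∂μ ≤ ∫ x in S, w x ^ (σ * b + (p - 1)) ∂μ := by
    refine setIntegral_mono_on (c2.integrableOn_compact hSc) i4 hSm fun x hx => ?_
    have hx0 := hpos x (hs hx)
    rw [hφ, Real.rpow_add hx0]
    have : 0 ≤ w x ^ (σ * b) * w x ^ (p - 1) := by positivity
    nlinarith [h1 x]
  rw [integral_sub (i3.const_mul _) (i4.const_mul _), integral_const_mul, integral_const_mul,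
    integral_const_mul] at m1
  have m3 := mul_le_mul_of_nonneg_left m2 hΛ
  rw [add_mul]
  have m4 := m1.trans (key.trans m3)
  linarith

end Caccioppoli

section Cutoff

variable {E : Type*} [NormedAddCommGroup E] [InnerProductSpace ℝ E] [FiniteDimensional ℝ E]
  [MeasurableSpace E] [BorelSpace E]

lemma exists_abs_deriv_smoothTransition_le :
    ∃ A : ℝ, 0 < A ∧ ∀ x, |deriv Real.smoothTransition x| ≤ A := by
  have hcont : Continuous (deriv Real.smoothTransition) :=
    (Real.smoothTransition.contDiff (n := 1)).continuous_deriv le_rfl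
  obtain ⟨A, hA⟩ := (isCompact_Icc (a := (0 : ℝ)) (b := 1)).exists_bound_of_continuousOn
    hcont.continuousOn
  refine ⟨max A 1, by positivity, fun x => ?_⟩
  by_cases hx : x ∈ Icc (0 : ℝ) 1
  · exact (hA x hx).trans (le_max_left _ _)
  · have : deriv Real.smoothTransition x = 0 := by
      rw [mem_Icc, not_and_or, not_le, not_le] at hx
      rcases hx with hx | hx
      · have : Real.smoothTransition =ᶠ[𝓝 x] fun _ => 0 := by
          filter_upwards [Iio_mem_nhds hx] with y hy
          exact Real.smoothTransition.zero_of_nonpos (le_of_lt hy)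
        rw [this.deriv_eq, deriv_const]
      · have : Real.smoothTransition =ᶠ[𝓝 x] fun _ => 1 := by
          filter_upwards [Ioi_mem_nhds hx] with y hy
          exact Real.smoothTransition.one_of_one_le (le_of_lt hy)
        rw [this.deriv_eq, deriv_const]
    rw [this]
    simp

/-- Cutoff functions `χ = η^p` between concentric balls. -/
lemma exists_cutoff {p : ℝ} (hp : 1 < p) :
    ∃ c : ℝ, 1 ≤ c ∧ ∀ θ' θ : ℝ, 0 ≤ θ' → θ' < θ → ∃ χ : E → ℝ, ContDiff ℝ 1 χ ∧
      tsupport χ ⊆ closedBall 0 θ ∧ (∀ x, 0 ≤ χ x) ∧ (∀ x, χ x ≤ 1) ∧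
      (∀ x ∈ closedBall (0 : E) θ', χ x = 1) ∧
      ∀ x, ‖gradient χ x‖ ≤ c / (θ - θ') * χ x ^ ((p - 1) / p) := by
  obtain ⟨A, hA0, hA⟩ := exists_abs_deriv_smoothTransition_le
  refine ⟨max (2 * p * A) 1, le_max_right _ _, fun θ' θ hθ' hθ => ?_⟩
  have hθ0 : 0 < θ := hθ'.trans_lt hθ
  have hδ : 0 < θ - θ' := by linarith
  have hD : 0 < θ ^ 2 - θ' ^ 2 := by nlinarith
  set g : E → ℝ := fun x => (θ ^ 2 - ‖x‖ ^ 2) / (θ ^ 2 - θ' ^ 2) with hg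
  set H : E → ℝ := fun x => Real.smoothTransition (g x) with hH
  have hH0 : ∀ x, 0 ≤ H x := fun x => Real.smoothTransition.nonneg _
  have hH1 : ∀ x, H x ≤ 1 := fun x => Real.smoothTransition.le_one _
  have hgd : ContDiff ℝ 1 g := (contDiff_const.sub (contDiff_norm_sq ℝ)).div_const _
  have hHd : ContDiff ℝ 1 H := Real.smoothTransition.contDiff.comp hgd
  have hzero : ∀ x, θ ≤ ‖x‖ → H x = 0 := fun x hx => by
    apply Real.smoothTransition.zero_of_nonpos
    apply div_nonpos_of_nonpos_of_nonneg _ hD.le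
    nlinarith
  refine ⟨fun x => H x ^ p, hHd.rpow_const_of_le (by simpa using hp.le), ?_,
    fun x => Real.rpow_nonneg (hH0 x) _, fun x => Real.rpow_le_one (hH0 x) (hH1 x) (by linarith),
    fun x hx => ?_, fun x => ?_⟩
  · refine closure_minimal (fun x hx => ?_) isClosed_closedBall
    by_contra hx'
    apply hx
    rw [mem_closedBall_zero_iff, not_le] at hx'
    simp [hzero x hx'.le, (by linarith : p ≠ 0)]
  · have : H x = 1 := by
      apply Real.smoothTransition.one_of_one_le
      rw [mem_closedBall_zero_iff] at hx
      rw [one_le_div hD]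
      nlinarith [norm_nonneg x]
    simp [this]
  · have e1 : (H x ^ p) ^ ((p - 1) / p) = H x ^ (p - 1) := by
      rw [← Real.rpow_mul (hH0 x), mul_div_cancel₀ _ (by linarith)]
    have d1 : HasFDerivAt g ((θ ^ 2 - θ' ^ 2)⁻¹ • (-((2 : ℕ) • (innerSL ℝ x : E →L[ℝ] ℝ)))) x := by
      have := ((hasStrictFDerivAt_norm_sq x).hasFDerivAt.const_sub (θ ^ 2)).mul_const
        (θ ^ 2 - θ' ^ 2)⁻¹
      simpa [hg, div_eq_mul_inv] using this
    have d2 : HasFDerivAt H (deriv Real.smoothTransition (g x) •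
        ((θ ^ 2 - θ' ^ 2)⁻¹ • (-((2 : ℕ) • (innerSL ℝ x : E →L[ℝ] ℝ))))) x :=
      ((Real.smoothTransition.contDiff (n := 1)).differentiable one_ne_zero
        (g x)).hasDerivAt.comp_hasFDerivAt x d1
    have d3 := d2.rpow_const (p := p) (Or.inr hp.le)
    rw [norm_gradient, d3.fderiv, e1, norm_smul, norm_smul, norm_smul, norm_neg]
    by_cases hx : θ ≤ ‖x‖
    · rw [hzero x hx, Real.zero_rpow (by linarith)]
      simp
    · push Not at hx
      have n1 : ‖(2 : ℕ) • (innerSL ℝ x : E →L[ℝ] ℝ)‖ ≤ 2 * θ := by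
        rw [← Nat.cast_smul_eq_nsmul ℝ, norm_smul, innerSL_apply_norm]
        simp only [Nat.cast_ofNat, Real.norm_ofNat]
        linarith
      have n2 : ‖p * H x ^ (p - 1)‖ = p * H x ^ (p - 1) := by
        rw [Real.norm_of_nonneg]
        have := hH0 x
        positivity
      have n3 : ‖(θ ^ 2 - θ' ^ 2)⁻¹‖ = (θ ^ 2 - θ' ^ 2)⁻¹ := Real.norm_of_nonneg (by positivity)
      have n4 : (θ ^ 2 - θ' ^ 2)⁻¹ * (2 * θ) ≤ 2 / (θ - θ') := by
        rw [inv_mul_eq_div, div_le_div_iff₀ hD hδ]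
        nlinarith
      have hHp : 0 ≤ H x ^ (p - 1) := Real.rpow_nonneg (hH0 x) _
      rw [n2, n3]
      calc p * H x ^ (p - 1) * (‖deriv Real.smoothTransition (g x)‖ *
            ((θ ^ 2 - θ' ^ 2)⁻¹ * ‖(2 : ℕ) • (innerSL ℝ x : E →L[ℝ] ℝ)‖))
          ≤ p * H x ^ (p - 1) * (A * ((θ ^ 2 - θ' ^ 2)⁻¹ * (2 * θ))) := by
            gcongr
            exact hA _
        _ ≤ p * H x ^ (p - 1) * (A * (2 / (θ - θ'))) := by gcongr
        _ = (2 * p * A) / (θ - θ') * H x ^ (p - 1) := by ring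
        _ ≤ _ := by
            gcongr
            exact le_max_left _ _

end Cutoff

section ReverseHolder

variable {E : Type*} [NormedAddCommGroup E] [InnerProductSpace ℝ E] [FiniteDimensional ℝ E]
  [MeasurableSpace E] [BorelSpace E]

lemma exists_integral_rpow_le_integral_norm_gradient (μ : Measure E) [μ.IsAddHaarMeasure] {κ : ℝ}
    (hκ : Real.HolderConjugate (Module.finrank ℝ E) κ) :
    ∃ C : ℝ, 0 ≤ C ∧ ∀ g : E → ℝ, ContDiff ℝ 1 g → HasCompactSupport g →
      ∫ x, |g x| ^ κ ∂μ ≤ C * (∫ x, ‖gradient g x‖ ∂μ) ^ κ := by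
  have hκ0 : 0 < κ := hκ.symm.pos
  refine ⟨(lintegralPowLePowLIntegralFDerivConst μ κ : ℝ), NNReal.coe_nonneg _,
    fun g hg hc => ?_⟩
  have key := lintegral_pow_le_pow_lintegral_fderiv μ hg hc hκ
  have i1 : Integrable (fun x => |g x| ^ κ) μ := by
    refine Continuous.integrable_of_hasCompactSupport
      (hg.continuous.abs.rpow_const fun _ => Or.inr hκ0.le) ?_
    refine hc.mono fun x hx => ?_
    simp only [Function.mem_support] at hx ⊢
    contrapose! hx
    simp [hx, hκ0.ne']
  have i2 : Integrable (fun x => ‖gradient g x‖) μ := by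
    simp_rw [norm_gradient]
    exact ((hg.continuous_fderiv one_ne_zero).norm).integrable_of_hasCompactSupport
      (hc.fderiv ℝ).norm
  have e1 : ∫⁻ x, ‖g x‖ₑ ^ κ ∂μ = ENNReal.ofReal (∫ x, |g x| ^ κ ∂μ) := by
    rw [ofReal_integral_eq_lintegral_ofReal i1 (ae_of_all _ fun x => by positivity)]
    refine lintegral_congr fun x => ?_
    rw [← ENNReal.ofReal_rpow_of_nonneg (abs_nonneg _) hκ0.le, Real.enorm_eq_ofReal_abs]
  have e2 : ∫⁻ x, ‖fderiv ℝ g x‖ₑ ∂μ = ENNReal.ofReal (∫ x, ‖gradient g x‖ ∂μ) := by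
    rw [ofReal_integral_eq_lintegral_ofReal i2 (ae_of_all _ fun x => by positivity)]
    refine lintegral_congr fun x => ?_
    rw [norm_gradient, ofReal_norm]
  have h0 : 0 ≤ ∫ x, ‖gradient g x‖ ∂μ := integral_nonneg fun x => norm_nonneg _
  rw [e1, e2, ENNReal.ofReal_rpow_of_nonneg h0 hκ0.le, ← ENNReal.ofReal_coe_nnreal,
    ← ENNReal.ofReal_mul (NNReal.coe_nonneg _)] at key
  rwa [ENNReal.ofReal_le_ofReal_iff (by positivity)] at key

/-- The weighted energy of a power on a ball is controlled by its integral on a larger ball. -/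
lemma exists_energy_le (μ : Measure E) [μ.IsAddHaarMeasure] {p Λ b₀ : ℝ} (hp : 1 < p) (hΛ : 0 ≤ Λ)
    (hb₀ : 0 < b₀) :
    ∃ C c : ℝ, 0 < C ∧ 1 ≤ c ∧ ∀ (w : E → ℝ) (σ b θ' θ : ℝ), ContDiffOn ℝ 1 w (ball 0 2) →
      (∀ x ∈ ball (0 : E) 2, 0 < w x) → HalfSol μ p σ Λ (ball 0 2) w → σ ^ 2 = 1 → b₀ ≤ b →
      0 ≤ θ' → θ' < θ → θ < 2 → θ - θ' ≤ 1 → ∃ χ : E → ℝ, ContDiff ℝ 1 χ ∧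
      tsupport χ ⊆ closedBall 0 θ ∧ (∀ x, 0 ≤ χ x) ∧ (∀ x, χ x ≤ 1) ∧
      (∀ x ∈ closedBall (0 : E) θ', χ x = 1) ∧ (∀ x, ‖gradient χ x‖ ≤ c / (θ - θ')) ∧
      ∫ x in tsupport χ, χ x * w x ^ (σ * b + (p - 1)) * (‖gradient w x‖ / w x) ^ p ∂μ ≤
        C * (c / (θ - θ')) ^ p * ∫ x in closedBall 0 θ, w x ^ (σ * b + (p - 1)) ∂μ := by
  obtain ⟨c, hc1, hcut⟩ := exists_cutoff (E := E) hp
  refine ⟨2 / b₀ * ((b₀ / 2) ^ (1 - p) + Λ), c, by positivity, hc1, ?_⟩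
  intro w σ b θ' θ hw hpos hsol hσ hb hθ' hθ hθ2 hθ1
  obtain ⟨χ, hχ, hs, h0, h1, hone, hgr⟩ := hcut θ' θ hθ' hθ
  have hδ : 0 < θ - θ' := by linarith
  have hcb : closedBall (0 : E) θ ⊆ ball 0 2 := closedBall_subset_ball hθ2
  have hG1 : 1 ≤ c / (θ - θ') := by rw [one_le_div hδ]; linarith
  set G := c / (θ - θ') with hG
  have hb0 : 0 < b := hb₀.trans_le hb
  refine ⟨χ, hχ, hs, h0, h1, hone, fun x => (hgr x).trans ?_, ?_⟩
  · have : χ x ^ ((p - 1) / p) ≤ 1 :=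
      Real.rpow_le_one (h0 x) (h1 x) (div_nonneg (by linarith) (by linarith))
    nlinarith
  have hcomp : HasCompactSupport χ :=
    (isCompact_closedBall (0 : E) θ).of_isClosed_subset (isClosed_tsupport _) hs
  have key := hsol.caccioppoli hp isOpen_ball hw hpos hσ hb0 hΛ hχ hcomp (hs.trans hcb) h0 h1
    (by linarith) hgr
  set q := σ * b + (p - 1) with hq
  have hint : IntegrableOn (fun x => w x ^ q) (closedBall 0 θ) μ :=
    ((hw.continuousOn.mono hcb).rpow_const fun x hx =>
      Or.inl (hpos x (hcb hx)).ne').integrableOn_compact (isCompact_closedBall _ _)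
  have hI : ∫ x in tsupport χ, w x ^ q ∂μ ≤ ∫ x in closedBall 0 θ, w x ^ q ∂μ :=
    setIntegral_mono_set hint
      ((ae_restrict_iff' measurableSet_closedBall).mpr (ae_of_all _ fun x hx =>
        Real.rpow_nonneg (hpos x (hcb hx)).le _)) hs.eventuallyLE
  have hI0 : 0 ≤ ∫ x in tsupport χ, w x ^ q ∂μ :=
    setIntegral_nonneg (isClosed_tsupport _).measurableSet fun x hx =>
      Real.rpow_nonneg (hpos x (hcb (hs hx))).le _
  set I := ∫ x in closedBall 0 θ, w x ^ q ∂μ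
  set J := ∫ x in tsupport χ, w x ^ q ∂μ
  set Z := ∫ x in tsupport χ, χ x * w x ^ q * (‖gradient w x‖ / w x) ^ p ∂μ
  have hGp : 1 ≤ G ^ p := Real.one_le_rpow hG1 (by linarith)
  have hbb : (b / 2) ^ (1 - p) ≤ (b₀ / 2) ^ (1 - p) :=
    Real.rpow_le_rpow_of_nonpos (by positivity) (by linarith) (by linarith)
  have hp0 : 0 ≤ (b₀ / 2) ^ (1 - p) := by positivity
  have s1 : ((b / 2) ^ (1 - p) * G ^ p + Λ) ≤ ((b₀ / 2) ^ (1 - p) + Λ) * G ^ p := by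
    nlinarith [mul_le_mul_of_nonneg_right hbb (by linarith : 0 ≤ G ^ p)]
  have s2 : ((b / 2) ^ (1 - p) * G ^ p + Λ) * J ≤ ((b₀ / 2) ^ (1 - p) + Λ) * G ^ p * I := by
    gcongr
  have hI' := hI0.trans hI
  have s3 : Z ≤ 2 / b * (((b₀ / 2) ^ (1 - p) + Λ) * G ^ p * I) := by
    have : Z = 2 / b * (b / 2 * Z) := by field_simp
    rw [this]
    exact mul_le_mul_of_nonneg_left (key.trans s2) (by positivity)
  calc Z ≤ 2 / b * (((b₀ / 2) ^ (1 - p) + Λ) * G ^ p * I) := s3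
    _ ≤ 2 / b₀ * (((b₀ / 2) ^ (1 - p) + Λ) * G ^ p * I) := by gcongr
    _ = _ := by ring

/-- A reverse Hölder inequality, the basic step of the Moser iteration. -/
lemma exists_reverse_holder (μ : Measure E) [μ.IsAddHaarMeasure] {p Λ b₀ κ : ℝ} (hp : 1 < p)
    (hΛ : 0 ≤ Λ) (hb₀ : 0 < b₀) (hκ : Real.HolderConjugate (Module.finrank ℝ E) κ) :
    ∃ A : ℝ, 1 ≤ A ∧ ∀ (w : E → ℝ) (σ b θ' θ : ℝ), ContDiffOn ℝ 1 w (ball 0 2) →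
      (∀ x ∈ ball (0 : E) 2, 0 < w x) → HalfSol μ p σ Λ (ball 0 2) w → σ ^ 2 = 1 → b₀ ≤ b →
      0 ≤ θ' → θ' < θ → θ ≤ 1 →
      ∫ x in closedBall 0 θ', w x ^ ((σ * b + (p - 1)) * κ) ∂μ ≤
        (A * (1 + |σ * b + (p - 1)|) / (θ - θ') *
          ∫ x in closedBall 0 θ, w x ^ (σ * b + (p - 1)) ∂μ) ^ κ := by
  obtain ⟨C, c, hC, hc1, hen⟩ := exists_energy_le (E := E) μ hp hΛ hb₀
  obtain ⟨D, hD, hsob⟩ := exists_integral_rpow_le_integral_norm_gradient μ hκ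
  have hκ0 : 0 < κ := hκ.symm.pos
  refine ⟨max 1 (D ^ κ⁻¹ * ((1 + C) * c)), le_max_left _ _, ?_⟩
  intro w σ b θ' θ hw hpos hsol hσ hb hθ' hθ hθ1
  obtain ⟨χ, hχ, hs, h0, h1, hone, hgr, hZ⟩ :=
    hen w σ b θ' θ hw hpos hsol hσ hb hθ' hθ (by linarith) (by linarith)
  have hδ : 0 < θ - θ' := by linarith
  have hcb : closedBall (0 : E) θ ⊆ ball 0 2 := closedBall_subset_ball (by linarith)
  have hcomp : HasCompactSupport χ :=
    (isCompact_closedBall (0 : E) θ).of_isClosed_subset (isClosed_tsupport _) hs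
  have hG1 : 1 ≤ c / (θ - θ') := by rw [one_le_div hδ]; linarith
  set G := c / (θ - θ') with hG
  set q := σ * b + (p - 1) with hq
  have hwc : ContinuousOn w (closedBall 0 θ) := hw.continuousOn.mono hcb
  have hne : ∀ x ∈ closedBall (0 : E) θ, w x ≠ 0 := fun x hx => (hpos x (hcb hx)).ne'
  have hrc : ∀ r : ℝ, ContinuousOn (fun x => w x ^ r) (closedBall 0 θ) := fun r =>
    hwc.rpow_const fun x hx => Or.inl (hne x hx)
  set S := tsupport χ with hS
  have hSm : MeasurableSet S := (isClosed_tsupport χ).measurableSet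
  have hgS : ContinuousOn (gradient w) S :=
    (hw.continuousOn_gradient isOpen_ball).mono (hs.trans hcb)
  have iI : IntegrableOn (fun x => w x ^ q) (closedBall 0 θ) μ :=
    (hrc q).integrableOn_compact (isCompact_closedBall _ _)
  have iZ : IntegrableOn (fun x => χ x * w x ^ q * (‖gradient w x‖ / w x) ^ p) S μ :=
    (((hχ.continuous.continuousOn.mul ((hrc q).mono hs))).mul
      ((hgS.norm.div (hwc.mono hs) fun x hx => hne x (hs hx)).rpow_const
        fun x hx => Or.inr (by linarith))).integrableOn_compact hcomp
  set g : E → ℝ := fun x => χ x * w x ^ q with hg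
  have hg1 : ContDiff ℝ 1 g := contDiff_cutoff_mul isOpen_ball hχ (hs.trans hcb)
    (hw.rpow_const_of_ne fun x hx => (hpos x hx).ne')
  have hgS' : tsupport g ⊆ S := closure_mono fun x hx => by
    simp only [hg, Function.mem_support] at hx ⊢
    exact left_ne_zero_of_mul hx
  have hgc : HasCompactSupport g := hcomp.of_isClosed_subset (isClosed_tsupport _) hgS'
  have key := hsob g hg1 hgc
  have hgrad : ∫ x, ‖gradient g x‖ ∂μ ≤ (1 + |q|) * ((1 + C) * G) *
      ∫ x in closedBall 0 θ, w x ^ q ∂μ := by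
    have e : ∫ x in S, ‖gradient g x‖ ∂μ = ∫ x, ‖gradient g x‖ ∂μ :=
      setIntegral_eq_integral_of_forall_compl_eq_zero fun x hx => by
        rw [gradient_of_notMem_tsupport (fun h => hx (hgS' h)), norm_zero]
    have m1 : ∫ x in S, ‖gradient g x‖ ∂μ ≤ ∫ x in S, ((1 + |q|) * (G * w x ^ q) +
        (1 + |q|) * (G ^ (1 - p) * (χ x * w x ^ q * (‖gradient w x‖ / w x) ^ p))) ∂μ := by
      refine setIntegral_mono_on
        (hg1.continuous_gradient.norm.continuousOn.integrableOn_compact hcomp)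
        ((((iI.mono_set hs).const_mul _).const_mul _).add ((iZ.const_mul _).const_mul _)) hSm
        fun x hx => ?_
      have hx0 := hpos x (hcb (hs hx))
      rw [gradient_cutoff_mul_rpow (hχ.differentiable one_ne_zero x)
        ((hw.contDiffAt (isOpen_ball.mem_nhds (hcb (hs hx)))).differentiableAt one_ne_zero) hx0]
      set z := ‖gradient w x‖ / w x with hz
      have hz0 : 0 ≤ z := by positivity
      have n1 : ‖gradient w x‖ = w x * z := by rw [hz]; field_simp
      have n2 : w x ^ (q - 1) * w x = w x ^ q := by
        rw [← Real.rpow_add_one hx0.ne']; ring_nf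
      have hz1 : z ≤ G + G ^ (1 - p) * z ^ p := by
        rcases le_total z G with h | h
        · have : 0 ≤ G ^ (1 - p) * z ^ p := by positivity
          linarith
        · have hzp : 0 < z := by linarith
          have : z = z ^ (1 - p) * z ^ p := by
            rw [← Real.rpow_add hzp]; simp
          have : z ^ (1 - p) * z ^ p ≤ G ^ (1 - p) * z ^ p := by
            gcongr ?_ * _
            exact Real.rpow_le_rpow_of_nonpos (by linarith) h (by linarith)
          linarith
      have hQ : 0 < w x ^ q := by positivity
      have hχ0 := h0 x
      have hχ1 := h1 x
      calc ‖(w x ^ q) • gradient χ x + (q * χ x * w x ^ (q - 1)) • gradient w x‖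
          ≤ w x ^ q * ‖gradient χ x‖ + |q| * χ x * w x ^ (q - 1) * ‖gradient w x‖ := by
            refine (norm_add_le _ _).trans (le_of_eq ?_)
            rw [norm_smul, norm_smul, norm_mul, norm_mul, Real.norm_of_nonneg hχ0,
              Real.norm_of_nonneg hQ.le,
              Real.norm_of_nonneg (by positivity : 0 ≤ w x ^ (q - 1)), Real.norm_eq_abs]
        _ = w x ^ q * ‖gradient χ x‖ + |q| * χ x * w x ^ q * z := by rw [n1, ← n2]; ring
        _ ≤ w x ^ q * G + |q| * χ x * w x ^ q * (G + G ^ (1 - p) * z ^ p) := by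
            gcongr
            exact hgr x
        _ = w x ^ q * G + |q| * χ x * w x ^ q * G +
              |q| * (G ^ (1 - p) * (χ x * w x ^ q * z ^ p)) := by ring
        _ ≤ w x ^ q * G + |q| * 1 * w x ^ q * G +
              (1 + |q|) * (G ^ (1 - p) * (χ x * w x ^ q * z ^ p)) := by
            gcongr
            linarith
        _ = _ := by ring
    rw [e, integral_add (((iI.mono_set hs).const_mul _).const_mul _)
      ((iZ.const_mul _).const_mul _), integral_const_mul, integral_const_mul, integral_const_mul,
      integral_const_mul] at m1
    have hI : ∫ x in S, w x ^ q ∂μ ≤ ∫ x in closedBall 0 θ, w x ^ q ∂μ :=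
      setIntegral_mono_set iI
        ((ae_restrict_iff' measurableSet_closedBall).mpr (ae_of_all _ fun x hx =>
          Real.rpow_nonneg (hpos x (hcb hx)).le _)) hs.eventuallyLE
    have hGG : G ^ (1 - p) * G ^ p = G := by
      rw [← Real.rpow_add (by linarith)]; simp
    calc _ ≤ _ := m1
      _ ≤ (1 + |q|) * (G * ∫ x in closedBall 0 θ, w x ^ q ∂μ) + (1 + |q|) * (G ^ (1 - p) *
          (C * G ^ p * ∫ x in closedBall 0 θ, w x ^ q ∂μ)) := by gcongr
      _ = (1 + |q|) * (G + C * (G ^ (1 - p) * G ^ p)) * ∫ x in closedBall 0 θ, w x ^ q ∂μ := by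
        ring
      _ = _ := by rw [hGG]; ring
  have hI0 : 0 ≤ ∫ x in closedBall 0 θ, w x ^ q ∂μ :=
    setIntegral_nonneg measurableSet_closedBall fun x hx =>
      Real.rpow_nonneg (hpos x (hcb hx)).le _
  have hleft : ∫ x in closedBall 0 θ', w x ^ (q * κ) ∂μ ≤ ∫ x, |g x| ^ κ ∂μ := by
    have e : ∫ x in closedBall 0 θ', w x ^ (q * κ) ∂μ =
        ∫ x in closedBall 0 θ', |g x| ^ κ ∂μ := by
      refine setIntegral_congr_fun measurableSet_closedBall fun x hx => ?_
      have hx0 := hpos x (hcb (closedBall_subset_closedBall hθ.le hx))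
      simp only [hg, hone x hx, one_mul]
      rw [abs_of_pos (by positivity), ← Real.rpow_mul hx0.le]
    rw [e]
    refine setIntegral_le_integral ?_ (ae_of_all _ fun x => by positivity)
    refine Continuous.integrable_of_hasCompactSupport
      (hg1.continuous.abs.rpow_const fun _ => Or.inr hκ0.le) ?_
    refine hgc.mono fun x hx => ?_
    simp only [Function.mem_support] at hx ⊢
    contrapose! hx
    simp [hx, hκ0.ne']
  set I := ∫ x in closedBall 0 θ, w x ^ q ∂μ with hI
  have hgi : 0 ≤ ∫ x, ‖gradient g x‖ ∂μ := integral_nonneg fun x => norm_nonneg _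
  calc _ ≤ _ := hleft
    _ ≤ D * (∫ x, ‖gradient g x‖ ∂μ) ^ κ := key
    _ = (D ^ κ⁻¹ * ∫ x, ‖gradient g x‖ ∂μ) ^ κ := by
        rw [Real.mul_rpow (by positivity) hgi, Real.rpow_inv_rpow hD hκ0.ne']
    _ ≤ (D ^ κ⁻¹ * ((1 + |q|) * ((1 + C) * G) * I)) ^ κ := by gcongr
    _ = (D ^ κ⁻¹ * ((1 + C) * c) * (1 + |q|) / (θ - θ') * I) ^ κ := by
        rw [hG]; ring_nf
    _ ≤ _ := by
        gcongr
        exact le_max_right _ _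

/-- The logarithm of a positive supersolution has bounded energy. -/
lemma exists_integral_norm_gradient_div_le (μ : Measure E) [μ.IsAddHaarMeasure] {p Λ : ℝ}
    (hp : 1 < p) (hΛ : 0 ≤ Λ) :
    ∃ C : ℝ, 0 ≤ C ∧ ∀ w : E → ℝ, ContDiffOn ℝ 1 w (ball 0 2) →
      (∀ x ∈ ball (0 : E) 2, 0 < w x) → HalfSol μ p (-1) Λ (ball 0 2) w →
      ∫ x in closedBall 0 1, ‖gradient w x‖ / w x ∂μ ≤ C := by
  obtain ⟨C, c, hC, hc1, hen⟩ := exists_energy_le (E := E) μ hp hΛ (b₀ := p - 1) (by linarith)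
  refine ⟨μ.real (closedBall 0 1) + C * (c / (3 / 2 - 1)) ^ p * μ.real (closedBall 0 (3 / 2)),
    by positivity, fun w hw hpos hsol => ?_⟩
  obtain ⟨χ, hχ, hs, h0, h1, hone, hgr, hZ⟩ := hen w (-1) (p - 1) 1 (3 / 2) hw hpos hsol
    (by norm_num) le_rfl (by norm_num) (by norm_num) (by norm_num) (by norm_num)
  have hcb : closedBall (0 : E) (3 / 2) ⊆ ball 0 2 := closedBall_subset_ball (by norm_num)
  have hcomp : HasCompactSupport χ :=
    (isCompact_closedBall (0 : E) _).of_isClosed_subset (isClosed_tsupport _) hs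
  have hq : -1 * (p - 1) + (p - 1) = 0 := by ring
  simp only [hq, Real.rpow_zero, mul_one, integral_const, smul_eq_mul, MeasurableSet.univ,
    measureReal_restrict_apply, univ_inter] at hZ
  have hsub : closedBall (0 : E) 1 ⊆ tsupport χ := fun x hx =>
    subset_tsupport _ (by simp [hone x hx])
  have hzc : ContinuousOn (fun x => ‖gradient w x‖ / w x) (tsupport χ) :=
    ((hw.continuousOn_gradient isOpen_ball).mono (hs.trans hcb)).norm.div
      (hw.continuousOn.mono (hs.trans hcb)) fun x hx => (hpos x (hcb (hs hx))).ne'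
  have hzp : ContinuousOn (fun x => χ x * (‖gradient w x‖ / w x) ^ p) (tsupport χ) :=
    hχ.continuous.continuousOn.mul (hzc.rpow_const fun x hx => Or.inr (by linarith))
  have ic : IntegrableOn (fun _ => (1 : ℝ)) (closedBall (0 : E) 1) μ :=
    integrableOn_const (isCompact_closedBall _ _).measure_lt_top.ne
  have iz := hzp.integrableOn_compact (μ := μ) hcomp
  have hn : ∀ x ∈ tsupport χ, 0 ≤ ‖gradient w x‖ / w x := fun x hx => by
    have := hpos x (hcb (hs hx))
    positivity
  calc ∫ x in closedBall 0 1, ‖gradient w x‖ / w x ∂μ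
      ≤ ∫ x in closedBall 0 1, (1 + χ x * (‖gradient w x‖ / w x) ^ p) ∂μ := by
        refine setIntegral_mono_on ((hzc.mono hsub).integrableOn_compact (isCompact_closedBall _ _))
          (ic.add (iz.mono_set hsub)) measurableSet_closedBall fun x hx => ?_
        rw [hone x hx, one_mul]
        have hz0 := hn x (hsub hx)
        rcases le_total (‖gradient w x‖ / w x) 1 with h | h
        · have : 0 ≤ (‖gradient w x‖ / w x) ^ p := by positivity
          linarith
        · have := Real.rpow_le_rpow_of_exponent_le h hp.le
          rw [Real.rpow_one] at this
          linarith
    _ = μ.real (closedBall 0 1) +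
        ∫ x in closedBall 0 1, χ x * (‖gradient w x‖ / w x) ^ p ∂μ := by
        rw [integral_add ic (iz.mono_set hsub)]
        simp
    _ ≤ μ.real (closedBall 0 1) +
        ∫ x in tsupport χ, χ x * (‖gradient w x‖ / w x) ^ p ∂μ := by
        refine add_le_add le_rfl ?_
        refine setIntegral_mono_set iz ?_ hsub.eventuallyLE
        refine (ae_restrict_iff' (isClosed_tsupport χ).measurableSet).mpr
          (ae_of_all _ fun x hx => ?_)
        have := hn x hx
        have := h0 x
        simp only [Pi.zero_apply]
        positivity
    _ ≤ _ := by gcongr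

end ReverseHolder

section Moser

variable {E : Type*} [NormedAddCommGroup E] [InnerProductSpace ℝ E] [FiniteDimensional ℝ E]
  [MeasurableSpace E] [BorelSpace E]

lemma moser_recursion {n κ B M : ℝ} (hκ : n.HolderConjugate κ) (hB : 1 ≤ B) (hM : 1 ≤ M)
    {I : ℕ → ℝ} (h0 : ∀ k, 0 ≤ I k) (h : ∀ k, I (k + 1) ≤ (B * M ^ k * I k) ^ κ) (k : ℕ) :
    I k ≤ (B ^ n * M ^ (n * (n - 1)) * I 0) ^ (κ ^ k) := by
  have hn : 1 < n := hκ.lt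
  have hκ0 : 0 < κ := hκ.symm.pos
  have hB0 : 0 < B := by linarith
  have hM0 : 0 < M := by linarith
  have e1 : n * κ = n + κ := hκ.mul_eq_add
  set J : ℕ → ℝ := fun k => B ^ n * M ^ (n * k + n * (n - 1)) * I k with hJ
  have hJ0 : ∀ k, 0 ≤ J k := fun k => by have := h0 k; positivity
  have step : ∀ k, J (k + 1) ≤ J k ^ κ := fun k => by
    have hk := h0 k
    calc J (k + 1) ≤ B ^ n * M ^ (n * ((k + 1 : ℕ) : ℝ) + n * (n - 1)) * (B * M ^ k * I k) ^ κ := by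
          simp only [hJ]; gcongr; exact h k
      _ = (B ^ n * B ^ κ) * (M ^ (n * ((k + 1 : ℕ) : ℝ) + n * (n - 1)) * M ^ (k * κ)) * I k ^ κ := by
          rw [Real.mul_rpow (by positivity) hk, Real.mul_rpow hB0.le (by positivity),
            ← Real.rpow_natCast M k, ← Real.rpow_mul hM0.le]
          ring
      _ = J k ^ κ := by
          simp only [hJ]
          rw [Real.mul_rpow (by positivity) hk, Real.mul_rpow (by positivity) (by positivity),
            ← Real.rpow_mul hB0.le, ← Real.rpow_mul hM0.le, ← Real.rpow_add hB0,
            ← Real.rpow_add hM0, e1]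
          congr 3
          push_cast
          linear_combination (-(k : ℝ) - n) * e1
  have main : ∀ k : ℕ, J k ≤ J 0 ^ (κ ^ k) := fun k => by
    induction k with
    | zero => simp
    | succ k ih =>
      calc J (k + 1) ≤ J k ^ κ := step k
        _ ≤ (J 0 ^ (κ ^ k)) ^ κ := Real.rpow_le_rpow (hJ0 k) ih hκ0.le
        _ = _ := by rw [← Real.rpow_mul (hJ0 0), pow_succ]
  have hIJ : I k ≤ J k := by
    have c1 : 1 ≤ B ^ n := Real.one_le_rpow hB (by linarith)
    have c2 : 1 ≤ M ^ (n * k + n * (n - 1)) := by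
      refine Real.one_le_rpow hM ?_
      have : 0 ≤ n - 1 := by linarith
      positivity
    exact le_mul_of_one_le_left (h0 k) (one_le_mul_of_one_le_of_one_le c1 c2)
  refine (hIJ.trans (main k)).trans (le_of_eq ?_)
  simp [hJ]

/-- A continuous function whose `κ ^ k`-th power means stay below `T` is bounded by `T`. -/
lemma le_of_forall_integral_rpow_pow_le (μ : Measure E) [μ.IsAddHaarMeasure] {κ T r : ℝ}
    (hκ : 1 < κ) (hT : 0 ≤ T) {f : E → ℝ} (hf : ContinuousOn f (closedBall 0 r))
    (hf0 : ∀ x ∈ closedBall (0 : E) r, 0 ≤ f x)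
    (h : ∀ k : ℕ, ∫ x in closedBall 0 r, f x ^ (κ ^ k) ∂μ ≤ T ^ (κ ^ k)) :
    ∀ x ∈ ball (0 : E) r, f x ≤ T := by
  intro x hx
  by_contra! hlt
  obtain ⟨T', hT1, hT2⟩ := exists_between hlt
  have hT'0 : 0 < T' := by linarith
  set O := {y ∈ ball (0 : E) r | T' < f y} with hO
  have hOo : IsOpen O := (hf.mono ball_subset_closedBall).isOpen_inter_preimage isOpen_ball isOpen_Ioi
  have hOs : O ⊆ closedBall 0 r := fun y hy => ball_subset_closedBall hy.1
  have hOfin : μ O ≠ ∞ :=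
    ((measure_mono hOs).trans_lt (isCompact_closedBall (0 : E) r).measure_lt_top).ne
  have hOpos : 0 < μ.real O :=
    ENNReal.toReal_pos (hOo.measure_pos μ ⟨x, hx, hT2⟩).ne' hOfin
  have hk : ∀ k : ℕ, μ.real O ≤ (T / T') ^ (κ ^ k) := fun k => by
    have hκk : 0 ≤ κ ^ k := by positivity
    have hint : IntegrableOn (fun x => f x ^ (κ ^ k)) (closedBall 0 r) μ :=
      (hf.rpow_const fun x _ => Or.inr hκk).integrableOn_compact (isCompact_closedBall _ _)
    have : T' ^ (κ ^ k) * μ.real O ≤ T ^ (κ ^ k) := by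
      calc T' ^ (κ ^ k) * μ.real O = ∫ x in O, T' ^ (κ ^ k) ∂μ := by
            simp [mul_comm]
        _ ≤ ∫ x in O, f x ^ (κ ^ k) ∂μ :=
            setIntegral_mono_on (integrableOn_const hOfin) (hint.mono_set hOs) hOo.measurableSet
              fun y hy => Real.rpow_le_rpow hT'0.le hy.2.le hκk
        _ ≤ ∫ x in closedBall 0 r, f x ^ (κ ^ k) ∂μ :=
            setIntegral_mono_set hint ((ae_restrict_iff' measurableSet_closedBall).mpr
              (ae_of_all _ fun y hy => Real.rpow_nonneg (hf0 y hy) _)) hOs.eventuallyLE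
        _ ≤ _ := h k
    rw [Real.div_rpow hT hT'0.le, le_div_iff₀ (by positivity), mul_comm]
    exact this
  have hlim : Tendsto (fun k : ℕ => (T / T') ^ (κ ^ k)) atTop (𝓝 0) :=
    (tendsto_rpow_atTop_of_base_lt_one _ (by have : 0 ≤ T / T' := by positivity
                                             linarith) ((div_lt_one hT'0).mpr hT1)).comp
      (tendsto_pow_atTop_atTop_of_one_lt hκ)
  exact absurd (ge_of_tendsto' hlim hk) (not_le.mpr hOpos)

/-- Local boundedness of powers, by Moser iteration. -/
lemma exists_rpow_le_integral (μ : Measure E) [μ.IsAddHaarMeasure] {p Λ b₀ q₀ κ : ℝ} (hp : 1 < p)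
    (hΛ : 0 ≤ Λ) (hb₀ : 0 < b₀) (hq₀ : 0 ≤ q₀)
    (hκ : Real.HolderConjugate (Module.finrank ℝ E) κ) :
    ∃ A : ℝ, 1 ≤ A ∧ ∀ (w : E → ℝ) (q θ' θ : ℝ), ContDiffOn ℝ 1 w (ball 0 2) →
      (∀ x ∈ ball (0 : E) 2, 0 < w x) → |q| ≤ q₀ →
      (∀ k : ℕ, ∃ σ b : ℝ, σ ^ 2 = 1 ∧ b₀ ≤ b ∧ HalfSol μ p σ Λ (ball 0 2) w ∧
        q * κ ^ k = σ * b + (p - 1)) →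
      0 ≤ θ' → θ' < θ → θ ≤ 1 → ∀ x ∈ ball (0 : E) θ',
      w x ^ q ≤ A * (1 / (θ - θ')) ^ (Module.finrank ℝ E) *
        ∫ x in closedBall 0 θ, w x ^ q ∂μ := by
  obtain ⟨A, hA, hrev⟩ := exists_reverse_holder μ hp hΛ hb₀ hκ
  set n : ℝ := (Module.finrank ℝ E : ℝ) with hn
  have hκ1 : 1 < κ := hκ.symm.lt
  have hn1 : 1 < n := hκ.lt
  have hAq : 1 ≤ 2 * A * (1 + q₀) := by nlinarith
  refine ⟨(2 * A * (1 + q₀)) ^ n * (2 * κ) ^ (n * (n - 1)), ?_, ?_⟩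
  · refine one_le_mul_of_one_le_of_one_le (Real.one_le_rpow hAq (by linarith))
      (Real.one_le_rpow (by linarith) ?_)
    have : 0 ≤ n - 1 := by linarith
    positivity
  intro w q θ' θ hw hpos hq hex hθ' hθ hθ1
  have hδ : 0 < θ - θ' := by linarith
  set t : ℕ → ℝ := fun k => θ' + (θ - θ') / 2 ^ k with ht
  have ht1 : ∀ k, θ' < t k := fun k => by simp only [ht]; linarith [show 0 < (θ - θ') / 2 ^ k by positivity]
  have ht2 : ∀ k, t k ≤ θ := fun k => by
    have : (θ - θ') / 2 ^ k ≤ θ - θ' := div_le_self hδ.le (one_le_pow₀ (by norm_num))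
    simp only [ht]; linarith
  have ht3 : ∀ k, t k - t (k + 1) = (θ - θ') / (2 * 2 ^ k) := fun k => by
    simp only [ht]; rw [pow_succ]; field_simp; ring
  have hsub : ∀ k, closedBall (0 : E) (t k) ⊆ ball 0 2 := fun k =>
    closedBall_subset_ball (by linarith [ht2 k])
  set I : ℕ → ℝ := fun k => ∫ x in closedBall 0 (t k), w x ^ (q * κ ^ k) ∂μ with hI
  have hI0 : ∀ k, 0 ≤ I k := fun k => setIntegral_nonneg measurableSet_closedBall fun x hx =>
    Real.rpow_nonneg (hpos x (hsub k hx)).le _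
  have hB : 1 ≤ 2 * A * (1 + q₀) / (θ - θ') := by
    rw [le_div_iff₀ hδ]; linarith
  have hstep : ∀ k, I (k + 1) ≤ (2 * A * (1 + q₀) / (θ - θ') * (2 * κ) ^ k * I k) ^ κ := fun k => by
    obtain ⟨σ, b, hσ, hb, hsol, hqb⟩ := hex k
    have hlt : t (k + 1) < t k := by
      have : 0 < t k - t (k + 1) := by rw [ht3]; positivity
      linarith
    have := hrev w σ b (t (k + 1)) (t k) hw hpos hsol hσ hb (hθ'.trans (ht1 _).le) hlt
      ((ht2 k).trans hθ1)
    rw [← hqb, ht3] at this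
    simp only [hI]
    rw [pow_succ, ← mul_assoc]
    refine this.trans (Real.rpow_le_rpow (mul_nonneg (by positivity) (hI0 k)) ?_ (by linarith))
    refine mul_le_mul_of_nonneg_right ?_ (hI0 k)
    have hκk : 1 ≤ κ ^ k := one_le_pow₀ hκ1.le
    have h1 : 1 + |q * κ ^ k| ≤ (1 + q₀) * κ ^ k := by
      rw [abs_mul, abs_of_pos (by positivity : 0 < κ ^ k)]
      nlinarith
    calc A * (1 + |q * κ ^ k|) / ((θ - θ') / (2 * 2 ^ k))
        ≤ A * ((1 + q₀) * κ ^ k) / ((θ - θ') / (2 * 2 ^ k)) := by gcongr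
      _ = _ := by rw [mul_pow]; field_simp
  have hrec := moser_recursion hκ hB (by linarith : 1 ≤ 2 * κ) hI0 hstep
  set T := (2 * A * (1 + q₀) / (θ - θ')) ^ n * (2 * κ) ^ (n * (n - 1)) * I 0 with hT
  have hT0 : 0 ≤ T := by have := hI0 0; positivity
  have hsub' : closedBall (0 : E) θ' ⊆ ball 0 2 := closedBall_subset_ball (by linarith)
  have hwc := hw.continuousOn.mono hsub'
  intro x hx
  have key := le_of_forall_integral_rpow_pow_le μ hκ1 hT0 (f := fun x => w x ^ q) (r := θ')
    (hwc.rpow_const fun x hx => Or.inl (hpos x (hsub' hx)).ne')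
    (fun x hx => Real.rpow_nonneg (hpos x (hsub' hx)).le _) (fun k => ?_) x hx
  · refine key.trans (le_of_eq ?_)
    rw [hT, Real.div_rpow (by positivity) hδ.le]
    simp only [hI, ht, pow_zero, div_one, mul_one, add_sub_cancel]
    rw [hn, Real.rpow_natCast (θ - θ'), one_div, inv_pow]
    field_simp
  · refine le_trans ?_ (hrec k)
    have hss : closedBall (0 : E) θ' ⊆ closedBall 0 (t k) := closedBall_subset_closedBall (ht1 k).le
    calc _ = ∫ x in closedBall 0 θ', w x ^ (q * κ ^ k) ∂μ :=
          setIntegral_congr_fun measurableSet_closedBall fun y hy => by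
            rw [← Real.rpow_mul (hpos y (hsub' hy)).le]
      _ ≤ I k := by
          refine setIntegral_mono_set ?_ ((ae_restrict_iff' measurableSet_closedBall).mpr
            (ae_of_all _ fun y hy => Real.rpow_nonneg (hpos y (hsub k hy)).le _)) hss.eventuallyLE
          exact ((hw.continuousOn.mono (hsub k)).rpow_const fun y hy =>
            Or.inl (hpos y (hsub k hy)).ne').integrableOn_compact (isCompact_closedBall _ _)

end Moser

section Poincare

variable {E : Type*} [NormedAddCommGroup E] [InnerProductSpace ℝ E] [FiniteDimensional ℝ E]
  [MeasurableSpace E] [BorelSpace E]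

lemma lintegral_comp_add_smul_le (μ : Measure E) [μ.IsAddHaarMeasure] {g : E → ℝ≥0∞}
    (hg : Measurable g) {t : ℝ} (ht : 1 / 2 ≤ t) (v : E) :
    ∫⁻ x, g (v + t • x) ∂μ ≤ 2 ^ Module.finrank ℝ E * ∫⁻ x, g x ∂μ := by
  have ht0 : 0 < t := by linarith
  have e : ∫⁻ x, g (v + t • x) ∂μ =
      ENNReal.ofReal |(t ^ Module.finrank ℝ E)⁻¹| * ∫⁻ x, g x ∂μ := by
    rw [← lintegral_map (μ := μ) (f := fun y => g (v + y)) (g := fun x => t • x)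
      (hg.comp (measurable_const_add v)) (measurable_const_smul t),
      Measure.map_addHaar_smul μ ht0.ne', lintegral_smul_measure, lintegral_add_left_eq_self,
      smul_eq_mul]
  rw [e]
  gcongr
  rw [abs_of_pos (by positivity), ← inv_pow]
  calc ENNReal.ofReal (t⁻¹ ^ Module.finrank ℝ E)
      ≤ ENNReal.ofReal (2 ^ Module.finrank ℝ E) := by
        gcongr
        rw [inv_le_comm₀ ht0 (by norm_num)]
        linarith
    _ = _ := by rw [ENNReal.ofReal_pow (by norm_num)]; simp

lemma lintegral_segment_le (μ : Measure E) [μ.IsAddHaarMeasure] {g : E → ℝ≥0∞}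
    (hg : Measurable g) (B : Set E) :
    ∫⁻ y in B, ∫⁻ x in B, (∫⁻ t in Icc (0 : ℝ) 1, g (y + t • (x - y))) ∂μ ∂μ ≤
      2 ^ Module.finrank ℝ E * μ B * ∫⁻ x, g x ∂μ := by
  have hm3 : Measurable fun z : (ℝ × E) × E => g (z.1.2 + z.1.1 • (z.2 - z.1.2)) :=
    hg.comp (by fun_prop)
  have hm2 : Measurable fun z : ℝ × E => ∫⁻ x in B, g (z.2 + z.1 • (x - z.2)) ∂μ :=
    Measurable.lintegral_prod_right' hm3
  have hkey : ∀ t ∈ Icc (0 : ℝ) 1, ∫⁻ y in B, ∫⁻ x in B, g (y + t • (x - y)) ∂μ ∂μ ≤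
      2 ^ Module.finrank ℝ E * μ B * ∫⁻ x, g x ∂μ := by
    intro t ht
    have aux : ∀ s : ℝ, 1 / 2 ≤ s → ∀ v : E → E, ∫⁻ y in B, ∫⁻ x in B, g (v y + s • x) ∂μ ∂μ ≤
        2 ^ Module.finrank ℝ E * μ B * ∫⁻ x, g x ∂μ := fun s hs v => by
      calc _ ≤ ∫⁻ y in B, 2 ^ Module.finrank ℝ E * ∫⁻ x, g x ∂μ ∂μ :=
            lintegral_mono fun y => (setLIntegral_le_lintegral _ _).trans
              (lintegral_comp_add_smul_le μ hg hs (v y))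
        _ = _ := by rw [setLIntegral_const]; ring
    rcases le_total (1 / 2) t with h | h
    · have e : ∀ x y : E, y + t • (x - y) = (1 - t) • y + t • x := fun x y => by module
      simp only [e]
      exact aux t h fun y => (1 - t) • y
    · have e : ∀ x y : E, y + t • (x - y) = t • x + (1 - t) • y := fun x y => by module
      have hm : Measurable (Function.uncurry fun y x : E => g (y + t • (x - y))) :=
        hg.comp (by fun_prop : Measurable fun z : E × E => z.1 + t • (z.2 - z.1))
      rw [lintegral_lintegral_swap hm.aemeasurable]
      simp only [e]
      exact aux (1 - t) (by linarith) fun x => t • x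
  calc _ = ∫⁻ y in B, ∫⁻ t in Icc (0 : ℝ) 1, (∫⁻ x in B, g (y + t • (x - y)) ∂μ) ∂volume ∂μ := by
        refine lintegral_congr fun y => ?_
        exact lintegral_lintegral_swap
          ((hm3.comp (by fun_prop : Measurable fun z : E × ℝ => ((z.2, y), z.1))).aemeasurable)
    _ = ∫⁻ t in Icc (0 : ℝ) 1, (∫⁻ y in B, ∫⁻ x in B, g (y + t • (x - y)) ∂μ ∂μ) ∂volume :=
        lintegral_lintegral_swap (hm2.comp measurable_swap).aemeasurable
    _ ≤ ∫⁻ t in Icc (0 : ℝ) 1, 2 ^ Module.finrank ℝ E * μ B * ∫⁻ x, g x ∂μ :=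
        setLIntegral_mono' measurableSet_Icc hkey
    _ = _ := by simp

/-- A weak Poincaré inequality on the unit ball. -/
lemma exists_integral_abs_sub_le (μ : Measure E) [μ.IsAddHaarMeasure] :
    ∃ C : ℝ, 0 ≤ C ∧ ∀ f : E → ℝ, ContDiffOn ℝ 1 f (ball 0 2) →
      ∃ a : ℝ, ∫ x in closedBall 0 1, |f x - a| ∂μ ≤
        C * ∫ x in closedBall 0 1, ‖gradient f x‖ ∂μ := by
  set n := Module.finrank ℝ E
  refine ⟨2 * 2 ^ n, by positivity, fun f hf => ?_⟩
  set B := closedBall (0 : E) 1 with hB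
  have hBm : MeasurableSet B := measurableSet_closedBall
  have hB2 : B ⊆ ball 0 2 := closedBall_subset_ball (by norm_num)
  have hB0 : μ B ≠ 0 := (measure_closedBall_pos μ _ one_pos).ne'
  have hBt : μ B ≠ ∞ := (isCompact_closedBall _ _).measure_lt_top.ne
  set g : E → ℝ≥0∞ := B.indicator fun x => ‖fderiv ℝ f x‖ₑ with hg
  have hgm : Measurable g := (measurable_fderiv ℝ f).enorm.indicator hBm
  have hseg : ∀ x ∈ B, ∀ y ∈ B, ∀ t ∈ Icc (0 : ℝ) 1, y + t • (x - y) ∈ B := fun x hx y hy t ht =>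
    (convex_closedBall (0 : E) 1).add_smul_sub_mem hy hx ht
  have hpt : ∀ x ∈ B, ∀ y ∈ B, ‖f x - f y‖ₑ ≤ 2 * ∫⁻ t in Icc (0 : ℝ) 1, g (y + t • (x - y)) := by
    intro x hx y hy
    have hmaps : MapsTo (fun t : ℝ => y + t • (x - y)) (Icc 0 1) (ball 0 2) :=
      fun t ht => hB2 (hseg x hx y hy t ht)
    have h1 : ContDiffOn ℝ 1 (fun t : ℝ => f (y + t • (x - y))) (Icc 0 1) :=
      hf.comp (by fun_prop) hmaps
    have h2 := enorm_sub_le_lintegral_deriv_of_contDiffOn_Icc h1 zero_le_one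
    simp only [one_smul, zero_smul, add_zero, add_sub_cancel] at h2
    refine h2.trans ?_
    have hgl : Measurable fun t : ℝ => g (y + t • (x - y)) :=
      hgm.comp (by fun_prop : Measurable fun t : ℝ => y + t • (x - y))
    rw [← lintegral_const_mul _ hgl]
    refine setLIntegral_mono' measurableSet_Icc fun t ht => ?_
    have hd : HasDerivAt (fun t : ℝ => f (y + t • (x - y)))
        (fderiv ℝ f (y + t • (x - y)) (x - y)) t := by
      have h3 : HasDerivAt (fun t : ℝ => y + t • (x - y)) (x - y) t := by
        simpa using ((hasDerivAt_id t).smul_const (x - y)).const_add y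
      exact ((hf.contDiffAt (isOpen_ball.mem_nhds (hmaps ht))).differentiableAt
        one_ne_zero).hasFDerivAt.comp_hasDerivAt t h3
    rw [hd.deriv, hg, indicator_of_mem (hseg x hx y hy t ht), mul_comm]
    refine (ContinuousLinearMap.le_opENorm _ _).trans ?_
    gcongr
    rw [← ofReal_norm]
    refine ENNReal.ofReal_le_of_le_toReal ?_
    simp only [hB, mem_closedBall, dist_zero_right] at hx hy
    simpa using (norm_sub_le x y).trans (by linarith)
  set h : E → ℝ≥0∞ := fun y => ∫⁻ x in B, (∫⁻ t in Icc (0 : ℝ) 1, g (y + t • (x - y))) ∂μ with hh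
  have hhm : Measurable h := by
    refine Measurable.lintegral_prod_right' (f := fun z : E × E =>
      ∫⁻ t in Icc (0 : ℝ) 1, g (z.1 + t • (z.2 - z.1))) ?_
    refine Measurable.lintegral_prod_right' (f := fun z : (E × E) × ℝ =>
      g (z.1.1 + z.2 • (z.1.2 - z.1.1))) ?_
    exact hgm.comp (by fun_prop)
  obtain ⟨y, hy, hle⟩ := exists_le_setLAverage hB0 hBt hhm.aemeasurable.restrict
  refine ⟨f y, ?_⟩
  have hgi : IntegrableOn (fun x => ‖gradient f x‖) B μ :=
    ((hf.continuousOn_gradient isOpen_ball).mono hB2).norm.integrableOn_compact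
      (isCompact_closedBall _ _)
  have hfi : IntegrableOn (fun x => |f x - f y|) B μ :=
    ((hf.continuousOn.mono hB2).sub continuousOn_const).abs.integrableOn_compact
      (isCompact_closedBall _ _)
  have hgG : ∫⁻ x, g x ∂μ = ENNReal.ofReal (∫ x in B, ‖gradient f x‖ ∂μ) := by
    rw [hg, lintegral_indicator hBm, ofReal_integral_eq_lintegral_ofReal hgi
      (ae_of_all _ fun x => norm_nonneg _)]
    exact lintegral_congr fun x => by rw [norm_gradient, ofReal_norm]
  have hfin : h y ≤ 2 ^ n * ∫⁻ x, g x ∂μ := by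
    refine hle.trans ?_
    rw [setLAverage_eq]
    refine ENNReal.div_le_of_le_mul ((lintegral_segment_le μ hgm B).trans (le_of_eq ?_))
    ring
  have hfull : ENNReal.ofReal (∫ x in B, |f x - f y| ∂μ) ≤
      ENNReal.ofReal (2 * 2 ^ n * ∫ x in B, ‖gradient f x‖ ∂μ) := by
    rw [ofReal_integral_eq_lintegral_ofReal hfi (ae_of_all _ fun x => abs_nonneg _)]
    calc ∫⁻ x in B, ENNReal.ofReal |f x - f y| ∂μ
        ≤ ∫⁻ x in B, (2 * ∫⁻ t in Icc (0 : ℝ) 1, g (y + t • (x - y))) ∂μ := by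
          refine setLIntegral_mono' hBm fun x hx => ?_
          rw [← Real.enorm_eq_ofReal_abs]
          exact hpt x hx y hy
      _ = 2 * h y := by
          rw [lintegral_const_mul]
          refine Measurable.lintegral_prod_right' (f := fun z : E × ℝ =>
            g (y + z.2 • (z.1 - y))) ?_
          exact hgm.comp (by fun_prop)
      _ ≤ 2 * (2 ^ n * ENNReal.ofReal (∫ x in B, ‖gradient f x‖ ∂μ)) := by
          rw [← hgG]; gcongr
      _ = _ := by
          rw [ENNReal.ofReal_mul (by positivity), ENNReal.ofReal_mul (by norm_num),
            ENNReal.ofReal_pow (by norm_num), ENNReal.ofReal_ofNat]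
          ring
  rwa [ENNReal.ofReal_le_ofReal_iff] at hfull
  have : 0 ≤ ∫ x in B, ‖gradient f x‖ ∂μ := integral_nonneg fun x => norm_nonneg _
  positivity

end Poincare

section BombieriGiusti

variable {E : Type*} [NormedAddCommGroup E] [InnerProductSpace ℝ E] [FiniteDimensional ℝ E]
  [MeasurableSpace E] [BorelSpace E]

lemma integral_exp_mul_le (μ : Measure E) [μ.IsAddHaarMeasure] {f : E → ℝ} {C q M θ : ℝ}
    (hf : ContinuousOn f (closedBall 0 1)) (hC : ∫ x in closedBall 0 1, |f x| ∂μ ≤ C)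
    (hq : 0 < q) (hM : 0 < M) (hθ : θ ≤ 1) (hfM : ∀ x ∈ closedBall (0 : E) θ, f x ≤ M) :
    ∫ x in closedBall 0 θ, Real.exp (q * f x) ∂μ ≤
      μ.real (closedBall 0 1) * Real.exp (q * M / 2) + Real.exp (q * M) * (2 * C / M) := by
  have hs : closedBall (0 : E) θ ⊆ closedBall 0 1 := closedBall_subset_closedBall hθ
  have i1 : IntegrableOn (fun x => |f x|) (closedBall (0 : E) 1) μ :=
    hf.abs.integrableOn_compact (isCompact_closedBall _ _)
  have i2 : IntegrableOn (fun x => Real.exp (q * f x)) (closedBall (0 : E) θ) μ :=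
    (Real.continuous_exp.comp_continuousOn
      (continuousOn_const.mul (hf.mono hs))).integrableOn_compact (isCompact_closedBall _ _)
  have ic : IntegrableOn (fun _ => Real.exp (q * M / 2)) (closedBall (0 : E) 1) μ :=
    integrableOn_const (isCompact_closedBall _ _).measure_lt_top.ne
  calc ∫ x in closedBall 0 θ, Real.exp (q * f x) ∂μ
      ≤ ∫ x in closedBall 0 θ, (Real.exp (q * M / 2) + Real.exp (q * M) * (2 / M) * |f x|) ∂μ := by
        refine setIntegral_mono_on i2 ((ic.mono_set hs).add ((i1.mono_set hs).const_mul _))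
          measurableSet_closedBall fun x hx => ?_
        have hx' := hfM x hx
        rcases le_total (f x) (M / 2) with h | h
        · have : Real.exp (q * f x) ≤ Real.exp (q * M / 2) := by
            rw [Real.exp_le_exp]; nlinarith
          have : 0 ≤ Real.exp (q * M) * (2 / M) * |f x| := by positivity
          linarith
        · have h1 : Real.exp (q * f x) ≤ Real.exp (q * M) := by
            rw [Real.exp_le_exp]; nlinarith
          have h2 : 1 ≤ 2 / M * |f x| := by
            rw [abs_of_nonneg (by linarith), div_mul_eq_mul_div, one_le_div hM]; linarith
          have : Real.exp (q * M) ≤ Real.exp (q * M) * (2 / M) * |f x| := by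
            rw [mul_assoc]
            exact le_mul_of_one_le_right (Real.exp_pos _).le h2
          have : 0 < Real.exp (q * M / 2) := Real.exp_pos _
          linarith
    _ ≤ ∫ x in closedBall 0 1, (Real.exp (q * M / 2) + Real.exp (q * M) * (2 / M) * |f x|) ∂μ :=
        setIntegral_mono_set (ic.add (i1.const_mul _))
          (ae_of_all _ fun x => by simp only [Pi.zero_apply]; positivity) hs.eventuallyLE
    _ = μ.real (closedBall 0 1) * Real.exp (q * M / 2) +
          Real.exp (q * M) * (2 / M) * ∫ x in closedBall 0 1, |f x| ∂μ := by
        rw [integral_add ic (i1.const_mul _), integral_const_mul]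
        simp
    _ ≤ μ.real (closedBall 0 1) * Real.exp (q * M / 2) + Real.exp (q * M) * (2 / M) * C := by
        gcongr
    _ = _ := by ring

lemma bombieri_giusti_step (μ : Measure E) [μ.IsAddHaarMeasure] {f : E → ℝ} {C q₀ A : ℝ} {n : ℕ}
    {Q : Set ℝ} (hf : ContinuousOn f (closedBall 0 1))
    (hC : ∫ x in closedBall 0 1, |f x| ∂μ ≤ C) (hC0 : 0 < C) (hA : 1 ≤ A) (hq₀ : 0 < q₀)
    (hQ : ∀ r, 0 < r → r ≤ q₀ → ∃ q ∈ Q, r / 2 ≤ q ∧ q ≤ r)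
    (hsup : ∀ q ∈ Q, ∀ θ' θ : ℝ, 1 / 2 ≤ θ' → θ' < θ → θ ≤ 1 → ∀ x ∈ ball (0 : E) θ',
      Real.exp (q * f x) ≤ A * (1 / (θ - θ')) ^ n * ∫ x in closedBall 0 θ, Real.exp (q * f x) ∂μ)
    {θ' θ M : ℝ} (hθ' : 1 / 2 ≤ θ') (hθ : θ' < θ) (hθ1 : θ ≤ 1)
    (hfM : ∀ x ∈ closedBall (0 : E) θ, f x ≤ M) (x : E) (hx : x ∈ closedBall (0 : E) θ') :
    f x ≤ 3 / 4 * M + (2 * C + 2 / q₀) * (A * 2 ^ n * (μ.real (closedBall 0 1) + 1)) ^ 4 *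
      (1 / (θ - θ')) ^ (4 * n) := by
  have hδ : 0 < θ - θ' := by linarith
  set m := μ.real (closedBall (0 : E) 1) with hm
  have hm0 : 0 ≤ m := measureReal_nonneg
  set P := A * 2 ^ n * (m + 1) * (1 / (θ - θ')) ^ n with hP
  have hP1 : 1 ≤ P := by
    have h1 : (1 : ℝ) ≤ 2 ^ n := one_le_pow₀ (by norm_num)
    have h2 : 1 ≤ (1 / (θ - θ')) ^ n := one_le_pow₀ (by rw [one_le_div hδ]; linarith)
    exact one_le_mul_of_one_le_of_one_le
      (one_le_mul_of_one_le_of_one_le (one_le_mul_of_one_le_of_one_le hA h1) (by linarith)) h2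
  have hP4 : P ≤ P ^ 4 := le_self_pow₀ hP1 (by norm_num)
  have hgoal : (2 * C + 2 / q₀) * (A * 2 ^ n * (m + 1)) ^ 4 * (1 / (θ - θ')) ^ (4 * n) =
      2 * C * P ^ 4 + 2 / q₀ * P ^ 4 := by
    rw [hP, mul_pow _ ((1 / (θ - θ')) ^ n), ← pow_mul, mul_comm n 4]; ring
  rw [hgoal]
  have hfx : f x ≤ M := hfM x (closedBall_subset_closedBall hθ.le hx)
  have hq0 : 0 < 2 / q₀ := by positivity
  rcases le_or_gt M (2 * C * P ^ 4) with hcase | hcase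
  · nlinarith
  have hMC : 2 * C < M := lt_of_le_of_lt (by nlinarith) hcase
  have hMpos : 0 < M := by linarith
  have hlog : 0 < Real.log (M / (2 * C)) := Real.log_pos (by rw [one_lt_div (by positivity)]; exact hMC)
  have hlogP : 4 * Real.log P ≤ Real.log (M / (2 * C)) := by
    rw [← Real.log_rpow (by linarith)]
    refine Real.log_le_log (by positivity) ?_
    rw [le_div_iff₀ (by positivity)]
    norm_cast
    linarith
  have hlogP0 : 0 ≤ Real.log P := Real.log_nonneg hP1
  set r := min q₀ (2 / M * Real.log (M / (2 * C))) with hr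
  have hr0 : 0 < r := lt_min hq₀ (by positivity)
  obtain ⟨q, hqQ, hq1, hq2⟩ := hQ r hr0 (min_le_left _ _)
  have hqpos : 0 < q := by linarith
  have hexp : Real.exp (q * M) * (2 * C / M) ≤ Real.exp (q * M / 2) := by
    have h1 : q * M / 2 ≤ Real.log (M / (2 * C)) := by
      have : q ≤ 2 / M * Real.log (M / (2 * C)) := hq2.trans (min_le_right _ _)
      calc q * M / 2 ≤ 2 / M * Real.log (M / (2 * C)) * M / 2 := by gcongr
        _ = _ := by field_simp
    have h2 : Real.exp (q * M / 2) ≤ M / (2 * C) := by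
      rwa [← Real.le_log_iff_exp_le (by positivity)]
    calc Real.exp (q * M) * (2 * C / M)
        = Real.exp (q * M / 2) * (Real.exp (q * M / 2) * (2 * C / M)) := by
          rw [← mul_assoc, ← Real.exp_add]; ring_nf
      _ ≤ Real.exp (q * M / 2) * (M / (2 * C) * (2 * C / M)) := by gcongr
      _ = _ := by field_simp
  have hxb : x ∈ ball (0 : E) ((θ + θ') / 2) :=
    closedBall_subset_ball (by linarith) hx
  have hmain : Real.exp (q * f x) ≤ P * Real.exp (q * M / 2) := by
    have h1 := hsup q hqQ ((θ + θ') / 2) θ (by linarith) (by linarith) hθ1 x hxb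
    have h2 := integral_exp_mul_le μ hf hC hqpos hMpos hθ1 hfM
    calc _ ≤ _ := h1
      _ ≤ A * (1 / (θ - (θ + θ') / 2)) ^ n * ((m + 1) * Real.exp (q * M / 2)) := by
          refine mul_le_mul_of_nonneg_left (by linarith) ?_
          have : 0 ≤ θ - (θ + θ') / 2 := by linarith
          positivity
      _ = _ := by
          have : 1 / (θ - (θ + θ') / 2) = 2 * (1 / (θ - θ')) := by
            rw [show θ - (θ + θ') / 2 = (θ - θ') / 2 by ring]
            field_simp
          rw [this, mul_pow, hP]; ring
  have hmain' : q * f x ≤ Real.log P + q * M / 2 := by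
    have := Real.log_le_log (Real.exp_pos _) hmain
    rwa [Real.log_mul (by linarith) (Real.exp_pos _).ne', Real.log_exp, Real.log_exp] at this
  have hf2 : f x ≤ Real.log P / q + M / 2 := by
    rw [← mul_le_mul_iff_right₀ hqpos]
    refine hmain'.trans (le_of_eq ?_)
    field_simp
  have hlP : Real.log P ≤ P ^ 4 := (Real.log_le_self (by linarith)).trans hP4
  have hPp : 0 < P ^ 4 := by positivity
  have hCP : 0 < 2 * C * P ^ 4 := by positivity
  have hdiv : Real.log P / q ≤ Real.log P / (r / 2) := by gcongr
  rcases min_choice q₀ (2 / M * Real.log (M / (2 * C))) with h | h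
  · rw [hr, h] at hdiv
    have : Real.log P / (q₀ / 2) ≤ 2 / q₀ * P ^ 4 := by
      rw [div_div_eq_mul_div, mul_comm, mul_div_right_comm]
      gcongr
    linarith
  · rw [hr, h] at hdiv
    have h3 : Real.log P / (2 / M * Real.log (M / (2 * C)) / 2) ≤ M / 4 := by
      rw [div_le_iff₀ (by positivity)]
      calc Real.log P ≤ Real.log (M / (2 * C)) / 4 := by linarith
        _ = _ := by field_simp
    have : 0 ≤ 2 / q₀ * P ^ 4 := by positivity
    linarith

/-- An abstract iteration lemma of Bombieri and Giusti. -/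
lemma exists_forall_le_of_exp_le (μ : Measure E) [μ.IsAddHaarMeasure] {C q₀ A : ℝ} (n : ℕ)
    (hC0 : 0 < C) (hA : 1 ≤ A) (hq₀ : 0 < q₀) :
    ∃ K : ℝ, ∀ (f : E → ℝ) (Q : Set ℝ), ContinuousOn f (closedBall 0 1) →
      ∫ x in closedBall 0 1, |f x| ∂μ ≤ C →
      (∀ r, 0 < r → r ≤ q₀ → ∃ q ∈ Q, r / 2 ≤ q ∧ q ≤ r) →
      (∀ q ∈ Q, ∀ θ' θ : ℝ, 1 / 2 ≤ θ' → θ' < θ → θ ≤ 1 → ∀ x ∈ ball (0 : E) θ',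
        Real.exp (q * f x) ≤
          A * (1 / (θ - θ')) ^ n * ∫ x in closedBall 0 θ, Real.exp (q * f x) ∂μ) →
      ∀ x ∈ closedBall (0 : E) (1 / 2), f x ≤ K := by
  set D := (2 * C + 2 / q₀) * (A * 2 ^ n * (μ.real (closedBall (0 : E) 1) + 1)) ^ 4 with hD
  have hD0 : 0 ≤ D := by positivity
  set m := 4 * n with hm
  set τ : ℝ := 1 - 1 / (8 * (m + 1)) with hτ
  have hτ1 : τ < 1 := by
    have : (0 : ℝ) < 1 / (8 * (m + 1)) := by positivity
    linarith
  have hτ0 : 0 < τ := by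
    have : (1 : ℝ) / (8 * (m + 1)) ≤ 1 / 8 := by
      gcongr
      have : (0 : ℝ) ≤ m := by positivity
      linarith
    linarith
  have hτm : 7 / 8 ≤ τ ^ m := by
    have h1 := one_add_mul_le_pow (a := -(1 / (8 * ((m : ℝ) + 1)))) (by linarith) m
    have h2 : (m : ℝ) * (1 / (8 * (m + 1))) ≤ 1 / 8 := by
      rw [mul_one_div, div_le_div_iff₀ (by positivity) (by norm_num)]
      linarith
    rw [← sub_eq_add_neg] at h1
    linarith
  set c : ℝ := (2 / (1 - τ)) ^ m with hc
  have h1τ : 0 < 1 - τ := by linarith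
  have hc0 : 0 ≤ c := by positivity
  refine ⟨7 * (D * c), fun f Q hf hC hQ hsup => ?_⟩
  obtain ⟨M₀, hM₀⟩ := (isCompact_closedBall (0 : E) 1).bddAbove_image hf
  set M := max M₀ 0 with hMdef
  have hfM : ∀ x ∈ closedBall (0 : E) 1, f x ≤ M := fun x hx =>
    (hM₀ (mem_image_of_mem f hx)).trans (le_max_left _ _)
  have hM : 0 ≤ M := le_max_right _ _
  set t : ℕ → ℝ := fun k => 1 - τ ^ k / 2 with ht
  have hpk : ∀ k, 0 < τ ^ k := fun k => by positivity
  have ht1 : ∀ k, t k ≤ 1 := fun k => by simp only [ht]; linarith [hpk k]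
  have ht0 : ∀ k, 1 / 2 ≤ t k := fun k => by
    have := pow_le_one₀ hτ0.le hτ1.le (n := k)
    simp only [ht]; linarith
  have htd : ∀ k, t (k + 1) - t k = τ ^ k * (1 - τ) / 2 := fun k => by
    simp only [ht]; ring
  have hclaim : ∀ N j : ℕ, ∀ x ∈ closedBall (0 : E) (t j),
      f x ≤ (3 / 4) ^ N * M + 7 * (D * c) / (τ ^ m) ^ j := by
    intro N
    induction N with
    | zero =>
      intro j x hx
      have : 0 ≤ 7 * (D * c) / (τ ^ m) ^ j := by positivity
      have := hfM x (closedBall_subset_closedBall (ht1 j) hx)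
      simp only [pow_zero, one_mul]
      linarith
    | succ N ih =>
      intro j x hx
      have hlt : t j < t (j + 1) := by
        have : 0 < t (j + 1) - t j := by rw [htd]; have := hpk j; positivity
        linarith
      have key := bombieri_giusti_step μ hf hC hC0 hA hq₀ hQ hsup (ht0 j) hlt (ht1 _)
        (M := (3 / 4) ^ N * M + 7 * (D * c) / (τ ^ m) ^ (j + 1)) (ih (j + 1)) x hx
      have e1 : (1 / (t (j + 1) - t j)) ^ m = c / (τ ^ m) ^ j := by
        have := hpk j
        rw [htd, hc, pow_right_comm τ m j, ← div_pow (2 / (1 - τ))]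
        congr 1
        field_simp
      rw [← hD, ← hm, e1] at key
      have e2 : 3 / 4 * (7 * (D * c) / (τ ^ m) ^ (j + 1)) ≤ 6 * (D * c) / (τ ^ m) ^ j := by
        rw [pow_succ, ← mul_div_assoc, div_le_div_iff₀ (by positivity) (by positivity)]
        have : 0 ≤ D * c * (τ ^ m) ^ j := by positivity
        nlinarith
      calc f x ≤ _ := key
        _ = (3 / 4) ^ (N + 1) * M + 3 / 4 * (7 * (D * c) / (τ ^ m) ^ (j + 1)) +
            D * c / (τ ^ m) ^ j := by ring
        _ ≤ (3 / 4) ^ (N + 1) * M + 6 * (D * c) / (τ ^ m) ^ j + D * c / (τ ^ m) ^ j := by gcongr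
        _ = _ := by ring
  intro x hx
  have hx0 : x ∈ closedBall (0 : E) (t 0) := by
    have : t 0 = 1 / 2 := by simp only [ht]; norm_num
    rwa [this]
  have hlim : Tendsto (fun N : ℕ => (3 / 4 : ℝ) ^ N * M + 7 * (D * c)) atTop
      (𝓝 (0 * M + 7 * (D * c))) :=
    ((tendsto_pow_atTop_nhds_zero_of_lt_one (by norm_num) (by norm_num)).mul_const M).add_const _
  rw [zero_mul, zero_add] at hlim
  refine ge_of_tendsto' hlim fun N => ?_
  simpa using hclaim N 0 x hx0

end BombieriGiusti

section Harnack

variable {E : Type*} [NormedAddCommGroup E] [InnerProductSpace ℝ E] [FiniteDimensional ℝ E]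
  [MeasurableSpace E] [BorelSpace E]

lemma exp_mul_log_sub_le (μ : Measure E) {w : E → ℝ} {q a A θ : ℝ} {x : E}
    (hpos : ∀ x ∈ closedBall (0 : E) θ, 0 < w x) (hx : x ∈ closedBall (0 : E) θ)
    (h : w x ^ q ≤ A * ∫ x in closedBall 0 θ, w x ^ q ∂μ) :
    Real.exp (q * (Real.log (w x) - a)) ≤
      A * ∫ x in closedBall 0 θ, Real.exp (q * (Real.log (w x) - a)) ∂μ := by
  have e : ∀ x ∈ closedBall (0 : E) θ,
      Real.exp (q * (Real.log (w x) - a)) = Real.exp (-(q * a)) * w x ^ q := fun x hx => by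
    rw [Real.rpow_def_of_pos (hpos x hx), ← Real.exp_add]; ring_nf
  rw [e x hx, setIntegral_congr_fun measurableSet_closedBall e, integral_const_mul]
  calc _ ≤ Real.exp (-(q * a)) * (A * ∫ x in closedBall 0 θ, w x ^ q ∂μ) := by gcongr
    _ = _ := by ring

/-- Positive supersolutions are bounded below in terms of the mean of their logarithm. -/
lemma exists_le_log_of_super (μ : Measure E) [μ.IsAddHaarMeasure] {p Λ : ℝ} (hp : 1 < p)
    (hΛ : 0 ≤ Λ) (hE : 2 ≤ Module.finrank ℝ E) :
    ∃ C K : ℝ, 0 < C ∧ ∀ w : E → ℝ, ContDiffOn ℝ 1 w (ball 0 2) →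
      (∀ x ∈ ball (0 : E) 2, 0 < w x) → HalfSol μ p (-1) Λ (ball 0 2) w →
      ∃ a : ℝ, ∫ x in closedBall 0 1, |Real.log (w x) - a| ∂μ ≤ C ∧
        ∀ x ∈ closedBall (0 : E) (1 / 2), a - K ≤ Real.log (w x) := by
  have hn : (1 : ℝ) < Module.finrank ℝ E := by exact_mod_cast hE
  have hκ := Real.HolderConjugate.conjExponent hn
  obtain ⟨C₁, hC₁, hgrad⟩ := exists_integral_norm_gradient_div_le (E := E) μ hp hΛ
  obtain ⟨C₂, hC₂, hpoin⟩ := exists_integral_abs_sub_le (E := E) μ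
  obtain ⟨A, hA, hmos⟩ := exists_rpow_le_integral (E := E) (b₀ := p - 1) (q₀ := 1) μ hp hΛ
    (by linarith) zero_le_one hκ
  have hC : 0 < C₂ * C₁ + 1 := by positivity
  obtain ⟨K, hK⟩ := exists_forall_le_of_exp_le (E := E) (q₀ := 1) μ (Module.finrank ℝ E) hC hA
    one_pos
  refine ⟨C₂ * C₁ + 1, K, hC, fun w hw hpos hsol => ?_⟩
  have hlog : ContDiffOn ℝ 1 (fun x => Real.log (w x)) (ball 0 2) :=
    hw.log fun x hx => (hpos x hx).ne'
  have hB : closedBall (0 : E) 1 ⊆ ball 0 2 := closedBall_subset_ball (by norm_num)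
  obtain ⟨a, ha⟩ := hpoin _ hlog
  have hg : ∫ x in closedBall 0 1, ‖gradient (fun x => Real.log (w x)) x‖ ∂μ =
      ∫ x in closedBall 0 1, ‖gradient w x‖ / w x ∂μ := by
    refine setIntegral_congr_fun measurableSet_closedBall fun x hx => ?_
    have hx0 := hpos x (hB hx)
    have hd := (hw.contDiffAt (isOpen_ball.mem_nhds (hB hx))).differentiableAt one_ne_zero
    simp only [norm_gradient]
    rw [(hd.hasFDerivAt.log hx0.ne').fderiv, norm_smul, Real.norm_of_nonneg (by positivity)]
    field_simp
  have hint : ∫ x in closedBall 0 1, |Real.log (w x) - a| ∂μ ≤ C₂ * C₁ + 1 := by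
    have := mul_le_mul_of_nonneg_left (hgrad w hw hpos hsol) hC₂
    rw [hg] at ha
    linarith
  refine ⟨a, hint, fun x hx => ?_⟩
  have key := hK (fun x => a - Real.log (w x)) (Ioc 0 1)
    (continuousOn_const.sub (hlog.continuousOn.mono hB)) (by simpa only [abs_sub_comm] using hint)
    (fun r hr hr1 => ⟨r, ⟨hr, hr1⟩, by linarith, le_rfl⟩) (fun q hq θ' θ hθ' hθ hθ1 x hx => ?_) x hx
  · linarith
  · have hsub : closedBall (0 : E) θ ⊆ ball 0 2 := closedBall_subset_ball (by linarith)
    have hmain := hmos w (-q) θ' θ hw hpos (by rw [abs_neg, abs_of_pos hq.1]; exact hq.2)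
      (fun k => ⟨-1, q * (Real.conjExponent (Module.finrank ℝ E)) ^ k + (p - 1), by norm_num, ?_,
        hsol, by ring⟩) (by linarith) hθ hθ1 x hx
    · have := exp_mul_log_sub_le (a := a) μ (fun x hx => hpos x (hsub hx))
        (ball_subset_closedBall (ball_subset_ball hθ.le hx)) hmain
      have e : ∀ t : ℝ, -q * (t - a) = q * (a - t) := fun t => by ring
      simpa only [e] using this
    · have := hκ.symm.pos
      have := hq.1
      have : 0 < q * (Real.conjExponent (Module.finrank ℝ E)) ^ k := by positivity
      linarith

/-- Positive solutions are bounded above in terms of the mean of their logarithm. -/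
lemma exists_log_le_of_super_sub (μ : Measure E) [μ.IsAddHaarMeasure] {p Λ C : ℝ} (hp : 1 < p)
    (hΛ : 0 ≤ Λ) (hC : 0 < C) (hE : 2 ≤ Module.finrank ℝ E) :
    ∃ K : ℝ, ∀ (w : E → ℝ) (a : ℝ), ContDiffOn ℝ 1 w (ball 0 2) →
      (∀ x ∈ ball (0 : E) 2, 0 < w x) → HalfSol μ p (-1) Λ (ball 0 2) w →
      HalfSol μ p 1 Λ (ball 0 2) w → ∫ x in closedBall 0 1, |Real.log (w x) - a| ∂μ ≤ C →
      ∀ x ∈ closedBall (0 : E) (1 / 2), Real.log (w x) ≤ a + K := by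
  have hn2 : (2 : ℝ) ≤ Module.finrank ℝ E := by exact_mod_cast hE
  have hn : (1 : ℝ) < Module.finrank ℝ E := by linarith
  have hκ := Real.HolderConjugate.conjExponent hn
  set κ := Real.conjExponent (Module.finrank ℝ E) with hκdef
  have hκ1 : 1 < κ := hκ.symm.lt
  have hκ2 : κ ≤ 2 := by
    rw [hκdef, Real.conjExponent, div_le_iff₀ (by linarith)]; linarith
  have hκ0 : 0 < κ := by linarith
  set s := Real.sqrt κ with hs
  have hs1 : 1 < s := by rw [hs, Real.lt_sqrt (by norm_num)]; simpa using hκ1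
  have hss : s * s = κ := Real.mul_self_sqrt hκ0.le
  have hs0 : 0 < s := by linarith
  have hp1 : 0 < p - 1 := by linarith
  have hinv : s⁻¹ < 1 := inv_lt_one_of_one_lt₀ hs1
  have hb₀ : 0 < (p - 1) * (1 - s⁻¹) := mul_pos hp1 (by linarith)
  have hq₀ : 0 < (p - 1) * s⁻¹ := by positivity
  obtain ⟨A, hA, hmos⟩ := exists_rpow_le_integral (E := E) (q₀ := (p - 1) * s⁻¹) μ hp hΛ hb₀ hq₀.le hκ
  obtain ⟨K, hK⟩ := exists_forall_le_of_exp_le (E := E) μ (Module.finrank ℝ E) hC hA hq₀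
  refine ⟨K, fun w a hw hpos hsuper hsubs hint x hx => ?_⟩
  have hlog : ContDiffOn ℝ 1 (fun x => Real.log (w x)) (ball 0 2) :=
    hw.log fun x hx => (hpos x hx).ne'
  have hB : closedBall (0 : E) 1 ⊆ ball 0 2 := closedBall_subset_ball (by norm_num)
  have key := hK (fun x => Real.log (w x) - a) (range fun m : ℕ => (p - 1) * s⁻¹ / κ ^ m)
    ((hlog.continuousOn.mono hB).sub continuousOn_const) hint (fun r hr hr1 => ?_) ?_ x hx
  · linarith
  · have hex : ∃ m : ℕ, (p - 1) * s⁻¹ / κ ^ m ≤ r := by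
      have hlim : Tendsto (fun m : ℕ => (p - 1) * s⁻¹ / κ ^ m) atTop (𝓝 0) :=
        tendsto_const_nhds.div_atTop (tendsto_pow_atTop_atTop_of_one_lt hκ1)
      exact ((hlim.eventually (gt_mem_nhds hr)).exists).imp fun m hm => hm.le
    classical
    refine ⟨_, ⟨Nat.find hex, rfl⟩, ?_, Nat.find_spec hex⟩
    rcases Nat.eq_zero_or_pos (Nat.find hex) with h | h
    · simp only [h, pow_zero, div_one]; linarith
    · obtain ⟨m, hm⟩ := Nat.exists_eq_succ_of_ne_zero h.ne'
      have h2 := Nat.find_min hex (m := m) (by omega)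
      simp only [hm, Nat.succ_eq_add_one]
      rw [not_le] at h2
      have h3 : (p - 1) * s⁻¹ / κ ^ (m + 1) = (p - 1) * s⁻¹ / κ ^ m / κ := by
        rw [pow_succ, div_div]
      rw [h3]
      calc r / 2 ≤ r / κ := by gcongr
        _ ≤ _ := by gcongr
  · rintro _ ⟨m, rfl⟩ θ' θ hθ' hθ hθ1 x hx
    have hsub : closedBall (0 : E) θ ⊆ ball 0 2 := closedBall_subset_ball (by linarith)
    refine exp_mul_log_sub_le μ (fun x hx => hpos x (hsub hx))
      (ball_subset_closedBall (ball_subset_ball hθ.le hx)) ?_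
    refine hmos w _ θ' θ hw hpos ?_ (fun k => ?_) (by linarith) hθ hθ1 x hx
    · rw [abs_of_pos (by positivity)]
      exact div_le_self hq₀.le (one_le_pow₀ hκ1.le)
    · rcases le_or_gt k m with h | h
      · refine ⟨-1, (p - 1) - (p - 1) * s⁻¹ / κ ^ m * κ ^ k, by norm_num, ?_, hsuper, by ring⟩
        have : (p - 1) * s⁻¹ / κ ^ m * κ ^ k ≤ (p - 1) * s⁻¹ := by
          rw [div_mul_eq_mul_div, div_le_iff₀ (by positivity)]
          gcongr
          exact hκ1.le
        linarith
      · refine ⟨1, (p - 1) * s⁻¹ / κ ^ m * κ ^ k - (p - 1), by norm_num, ?_, hsubs, by ring⟩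
        have h1 : (p - 1) * s ≤ (p - 1) * s⁻¹ / κ ^ m * κ ^ k := by
          rw [div_mul_eq_mul_div, le_div_iff₀ (by positivity)]
          calc (p - 1) * s * κ ^ m = (p - 1) * s⁻¹ * κ ^ (m + 1) := by
                rw [pow_succ, ← hss]; field_simp
            _ ≤ _ := by
                gcongr
                · exact hκ1.le
                · omega
        have h2 : 2 ≤ s + s⁻¹ := by
          have : s + s⁻¹ - 2 = (s - 1) ^ 2 / s := by field_simp; ring
          have : 0 ≤ (s - 1) ^ 2 / s := by positivity
          linarith
        nlinarith

/-- The Harnack inequality. -/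
lemma exists_harnack (μ : Measure E) [μ.IsAddHaarMeasure] {p Λ : ℝ} (hp : 1 < p)
    (hΛ : 0 ≤ Λ) (hE : 2 ≤ Module.finrank ℝ E) :
    ∃ K : ℝ, 0 < K ∧ ∀ w : E → ℝ, ContDiffOn ℝ 1 w (ball 0 2) →
      (∀ x ∈ ball (0 : E) 2, 0 < w x) → HalfSol μ p (-1) Λ (ball 0 2) w →
      HalfSol μ p 1 Λ (ball 0 2) w → ∀ x ∈ closedBall (0 : E) (1 / 2),
      ∀ y ∈ closedBall (0 : E) (1 / 2), w x ≤ K * w y := by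
  obtain ⟨C, K₁, hC, h1⟩ := exists_le_log_of_super (E := E) μ hp hΛ hE
  obtain ⟨K₂, h2⟩ := exists_log_le_of_super_sub (E := E) μ hp hΛ hC hE
  refine ⟨Real.exp (K₁ + K₂), Real.exp_pos _, fun w hw hpos hsup hsub x hx y hy => ?_⟩
  obtain ⟨a, ha, hlow⟩ := h1 w hw hpos hsup
  have h3 := h2 w a hw hpos hsup hsub ha x hx
  have h4 := hlow y hy
  have hB : closedBall (0 : E) (1 / 2) ⊆ ball 0 2 := closedBall_subset_ball (by norm_num)
  rw [← Real.log_le_log_iff (hpos x (hB hx)) (mul_pos (Real.exp_pos _) (hpos y (hB hy))),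
    Real.log_mul (Real.exp_pos _).ne' (hpos y (hB hy)).ne', Real.log_exp]
  linarith

/-- If a positive supersolution is very small at one point, then it is small somewhere in every
ball of a given radius. -/
lemma exists_small_in_ball (μ : Measure E) [μ.IsAddHaarMeasure] {p Λ : ℝ} (hp : 1 < p)
    (hΛ : 0 ≤ Λ) (hE : 2 ≤ Module.finrank ℝ E) {ρ δ : ℝ} (hρ : 0 < ρ) (hδ : 0 < δ) :
    ∃ ε : ℝ, 0 < ε ∧ ∀ w : E → ℝ, ContDiffOn ℝ 1 w (ball 0 2) →
      (∀ x ∈ ball (0 : E) 2, 0 < w x) → HalfSol μ p (-1) Λ (ball 0 2) w →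
      (∃ x ∈ closedBall (0 : E) (1 / 2), w x ≤ ε) →
      ∀ z ∈ closedBall (0 : E) (1 / 2), ∃ y ∈ ball z ρ, w y ≤ δ := by
  obtain ⟨C, K, hC, h1⟩ := exists_le_log_of_super (E := E) μ hp hΛ hE
  set r := min ρ (1 / 2) with hr
  have hr0 : 0 < r := lt_min hρ (by norm_num)
  set m := μ.real (ball (0 : E) r) with hm
  have hm0 : 0 < m := ENNReal.toReal_pos (measure_ball_pos μ _ hr0).ne' measure_ball_lt_top.ne
  refine ⟨Real.exp (Real.log δ - K - C / m - 1), Real.exp_pos _, ?_⟩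
  rintro w hw hpos hsup ⟨x, hx, hxε⟩ z hz
  obtain ⟨a, ha, hlow⟩ := h1 w hw hpos hsup
  by_contra! hcon
  have hB : closedBall (0 : E) 1 ⊆ ball 0 2 := closedBall_subset_ball (by norm_num)
  have hB' : closedBall (0 : E) (1 / 2) ⊆ ball 0 2 := closedBall_subset_ball (by norm_num)
  have hx1 := hlow x hx
  have hx2 : Real.log (w x) ≤ Real.log δ - K - C / m - 1 := by
    rwa [Real.log_le_iff_le_exp (hpos x (hB' hx))]
  have hzs : ball z r ⊆ closedBall (0 : E) 1 := fun y hy => by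
    simp only [mem_ball, mem_closedBall, dist_eq_norm, sub_zero] at hy hz ⊢
    have : r ≤ 1 / 2 := min_le_right _ _
    calc ‖y‖ = ‖(y - z) + z‖ := by simp
      _ ≤ _ := norm_add_le _ _
      _ ≤ 1 := by linarith
  have hc : ContinuousOn (fun x => |Real.log (w x) - a|) (closedBall (0 : E) 1) :=
    (((hw.continuousOn.mono hB).log fun x hx => (hpos x (hB hx)).ne').sub continuousOn_const).abs
  have hi : IntegrableOn (fun x => |Real.log (w x) - a|) (closedBall (0 : E) 1) μ :=
    hc.integrableOn_compact (isCompact_closedBall _ _)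
  have hle : (C / m + 1) * m ≤ C := by
    calc (C / m + 1) * m = ∫ x in ball z r, (C / m + 1) ∂μ := by
          rw [setIntegral_const, hm, Measure.real, Measure.real, Measure.addHaar_ball_center μ z,
            smul_eq_mul, mul_comm]
      _ ≤ ∫ x in ball z r, |Real.log (w x) - a| ∂μ := by
          refine setIntegral_mono_on (integrableOn_const measure_ball_lt_top.ne)
            (hi.mono_set hzs) measurableSet_ball fun y hy => ?_
          have h3 := hcon y (ball_subset_ball (min_le_left _ _) hy)
          have h4 : Real.log δ < Real.log (w y) := Real.log_lt_log hδ h3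
          refine le_trans ?_ (le_abs_self _)
          linarith
      _ ≤ ∫ x in closedBall 0 1, |Real.log (w x) - a| ∂μ :=
          setIntegral_mono_set hi (ae_of_all _ fun x => abs_nonneg _) hzs.eventuallyLE
      _ ≤ C := ha
  have : (C / m + 1) * m = C + m := by field_simp
  linarith

end Harnack

section Transformations

variable {E : Type*} [NormedAddCommGroup E] [InnerProductSpace ℝ E] [FiniteDimensional ℝ E]
  [MeasurableSpace E] [BorelSpace E]

lemma integrable_of_continuousOn_compact {μ : Measure E} [IsFiniteMeasureOnCompacts μ] {f : E → ℝ}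
    {K : Set E} (hK : IsCompact K) (hf : ContinuousOn f K) (h0 : ∀ x ∉ K, f x = 0) :
    Integrable f μ :=
  (hf.integrableOn_compact hK).integrable_of_forall_notMem_eq_zero h0

lemma continuousOn_rpow_mul {w φ : E → ℝ} {U : Set E} {q : ℝ} (hw : ContinuousOn w U)
    (hpos : ∀ x ∈ U, 0 < w x) (hφ : Continuous φ) : ContinuousOn (fun x => w x ^ q * φ x) U :=
  (hw.rpow_const fun x hx => Or.inl (hpos x hx).ne').mul hφ.continuousOn

lemma integrable_rpow_mul {μ : Measure E} [IsFiniteMeasureOnCompacts μ] {w φ : E → ℝ} {U : Set E}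
    {q : ℝ} (hw : ContinuousOn w U) (hpos : ∀ x ∈ U, 0 < w x) (hφ : Continuous φ)
    (hc : HasCompactSupport φ) (hs : tsupport φ ⊆ U) : Integrable (fun x => w x ^ q * φ x) μ :=
  integrable_of_continuousOn_compact hc ((continuousOn_rpow_mul hw hpos hφ).mono hs) fun x hx => by
    simp [image_eq_zero_of_notMem_tsupport hx]

lemma gradient_comp_add_smul (f : E → ℝ) (x₀ y : E) (s : ℝ) :
    gradient (fun y => f (x₀ + s • y)) y = s • gradient f (x₀ + s • y) := by
  have h := fderiv_comp_smul (𝕜 := ℝ) (f := fun z => f (x₀ + z)) (x := y) s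
  simp only [fderiv_comp_add_left] at h
  simp [gradient, h]

lemma gradient_const_sub (f : E → ℝ) (c : ℝ) (x : E) :
    gradient (fun y => c - f y) x = -gradient f x := by
  simp [gradient, fderiv_const_sub]

lemma integral_comp_add_smul (μ : Measure E) [μ.IsAddHaarMeasure] (f : E → ℝ) (x₀ : E) {s : ℝ}
    (hs : 0 < s) :
    ∫ y, f (x₀ + s • y) ∂μ = (s ^ Module.finrank ℝ E)⁻¹ * ∫ x, f x ∂μ := by
  rw [Measure.integral_comp_smul μ (fun z => f (x₀ + z)) s, integral_add_left_eq_self,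
    abs_of_pos (by positivity), smul_eq_mul]

lemma HalfSol.scale {μ : Measure E} [μ.IsAddHaarMeasure] {p σ Λ s r : ℝ} {U : Set E} {u : E → ℝ}
    {x₀ : E} (h : HalfSol μ p σ Λ U u) (hs : 0 < s) (hU : ball x₀ (r * s) ⊆ U) :
    HalfSol μ p σ (s ^ p * Λ) (ball 0 r) (fun y => u (x₀ + s • y)) := by
  intro φ hφ hc hsupp h0
  set ψ : E → ℝ := fun x => φ (s⁻¹ • (x - x₀)) with hψ
  have e : ∀ y, ψ (x₀ + s • y) = φ y := fun y => by simp [hψ, smul_smul, hs.ne']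
  have hg : ∀ y, gradient φ y = s • gradient ψ (x₀ + s • y) := fun y => by
    rw [← gradient_comp_add_smul]; simp [e]
  let T : E ≃ₜ E := (Homeomorph.addRight (-x₀)).trans (Homeomorph.smulOfNeZero s⁻¹ (inv_ne_zero hs.ne'))
  have hT : ψ = φ ∘ T := by
    ext x
    simp [hψ, T, sub_eq_add_neg]
  have hψc : HasCompactSupport ψ := hT ▸ hc.comp_homeomorph T
  have hψs : tsupport ψ ⊆ U := by
    refine fun x hx => hU ?_
    have := hsupp (tsupport_comp_subset_preimage φ T.continuous (hT ▸ hx))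
    have h2 : T x = s⁻¹ • (x - x₀) := by simp [T, sub_eq_add_neg]
    rw [h2, mem_ball_zero_iff, norm_smul, Real.norm_of_nonneg (by positivity),
      inv_mul_lt_iff₀ hs] at this
    rw [mem_ball_iff_norm]
    linarith
  have key := h ψ (by fun_prop) hψc hψs fun x => h0 _
  have e1 : ∀ y, ‖gradient (fun y => u (x₀ + s • y)) y‖ ^ (p - 2) *
      ⟪gradient (fun y => u (x₀ + s • y)) y, gradient φ y⟫ = s ^ p *
      (fun x => ‖gradient u x‖ ^ (p - 2) * ⟪gradient u x, gradient ψ x⟫) (x₀ + s • y) := by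
    intro y
    rw [gradient_comp_add_smul, hg, norm_smul, Real.norm_of_nonneg hs.le,
      Real.mul_rpow hs.le (norm_nonneg _), real_inner_smul_left, real_inner_smul_right]
    have : s ^ p = s ^ (p - 2) * (s * s) := by
      rw [← sq, ← Real.rpow_natCast s 2, ← Real.rpow_add hs]; norm_num
    rw [this]; ring
  have e2 : ∀ y, u (x₀ + s • y) ^ (p - 1) * φ y =
      (fun x => u x ^ (p - 1) * ψ x) (x₀ + s • y) := by
    intro y; simp [e]
  rw [integral_congr_ae (ae_of_all μ e1), integral_congr_ae (ae_of_all μ e2), integral_const_mul,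
    integral_comp_add_smul μ (fun x => ‖gradient u x‖ ^ (p - 2) * ⟪gradient u x, gradient ψ x⟫) _ hs,
    integral_comp_add_smul μ (fun x => u x ^ (p - 1) * ψ x) _ hs]
  have := mul_le_mul_of_nonneg_left key
    (by positivity : 0 ≤ s ^ p * (s ^ Module.finrank ℝ E)⁻¹)
  calc _ = _ := by ring
    _ ≤ _ := this
    _ = _ := by ring

lemma HalfSol.mono {μ : Measure E} {p σ Λ Λ' : ℝ} {U U' : Set E} {u : E → ℝ}
    (h : HalfSol μ p σ Λ U u) (hU : U' ⊆ U) (hΛ : Λ ≤ Λ') (hpos : ∀ x ∈ U', 0 ≤ u x) :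
    HalfSol μ p σ Λ' U' u := by
  intro φ hφ hc hs h0
  refine (h φ hφ hc (hs.trans hU) h0).trans (mul_le_mul_of_nonneg_right hΛ ?_)
  refine integral_nonneg fun x => ?_
  by_cases hx : x ∈ tsupport φ
  · exact mul_nonneg (Real.rpow_nonneg (hpos x (hs hx)) _) (h0 x)
  · simp [image_eq_zero_of_notMem_tsupport hx]

lemma integral_flux_const_sub (μ : Measure E) (p c : ℝ) (u φ : E → ℝ) :
    ∫ x, ‖gradient (fun y => c - u y) x‖ ^ (p - 2) *
      ⟪gradient (fun y => c - u y) x, gradient φ x⟫ ∂μ =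
    -∫ x, ‖gradient u x‖ ^ (p - 2) * ⟪gradient u x, gradient φ x⟫ ∂μ := by
  rw [← integral_neg]
  simp [gradient_const_sub]

lemma HalfSol.const_sub_super {μ : Measure E} {p : ℝ} {U : Set E} {u : E → ℝ}
    (h : HalfSol μ p 1 0 U u) (c : ℝ) : HalfSol μ p (-1) 0 U (fun x => c - u x) := by
  intro φ hφ hc hs h0
  rw [integral_flux_const_sub]
  simpa using h φ hφ hc hs h0

lemma HalfSol.const_sub_sub {μ : Measure E} [IsFiniteMeasureOnCompacts μ] {p Λ L k c : ℝ}
    {U : Set E} {u : E → ℝ} (hp : 1 < p) (hΛ : 0 ≤ Λ)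
    (h : HalfSol μ p (-1) Λ U u) (hcont : ContinuousOn u U) (hpos : ∀ x ∈ U, 0 < u x)
    (hL : ∀ x ∈ U, u x ≤ L) (hk : 0 < k) (hck : ∀ x ∈ U, k ≤ c - u x) :
    HalfSol μ p 1 (Λ * (L / k) ^ (p - 1)) U (fun x => c - u x) := by
  intro φ hφ hc hs h0
  rw [integral_flux_const_sub]
  have h1 := h φ hφ hc hs h0
  have h2 : ∫ x, u x ^ (p - 1) * φ x ∂μ ≤
      ∫ x, (L / k) ^ (p - 1) * ((c - u x) ^ (p - 1) * φ x) ∂μ := by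
    refine integral_mono (integrable_rpow_mul hcont hpos hφ.continuous hc hs)
      ((integrable_rpow_mul (continuousOn_const.sub hcont) (fun x hx => hk.trans_le (hck x hx))
        hφ.continuous hc hs).const_mul _) fun x => ?_
    by_cases hx : x ∈ tsupport φ
    · have hx := hs hx
      have hL0 : 0 < L := (hpos x hx).trans_le (hL x hx)
      simp only
      rw [← mul_assoc, ← Real.mul_rpow (by positivity) (hk.le.trans (hck x hx))]
      refine mul_le_mul_of_nonneg_right ?_ (h0 x)
      refine Real.rpow_le_rpow (hpos x hx).le ((hL x hx).trans ?_) (by linarith)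
      rw [div_mul_eq_mul_div, le_div_iff₀ hk]
      exact mul_le_mul_of_nonneg_left (hck x hx) hL0.le
    · simp [image_eq_zero_of_notMem_tsupport hx]
  rw [integral_const_mul] at h2
  have := mul_le_mul_of_nonneg_left h2 hΛ
  linarith

end Transformations

section SmoothTest

variable {E : Type*} [NormedAddCommGroup E] [InnerProductSpace ℝ E] [FiniteDimensional ℝ E]
  [MeasurableSpace E] [BorelSpace E]

open scoped Convolution ContDiff in
lemma exists_smooth_approx (μ : Measure E) [μ.IsAddHaarMeasure] {φ : E → ℝ} {U : Set E}
    (hφ : ContDiff ℝ 1 φ) (hc : HasCompactSupport φ) (hU : IsOpen U) (hs : tsupport φ ⊆ U)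
    (h0 : ∀ x, 0 ≤ φ x) :
    ∃ K, IsCompact K ∧ K ⊆ U ∧ tsupport φ ⊆ K ∧ ∀ ε > 0, ∃ ψ : E → ℝ, ContDiff ℝ ∞ ψ ∧
      tsupport ψ ⊆ K ∧ (∀ x, 0 ≤ ψ x) ∧ (∀ x, |ψ x - φ x| ≤ ε) ∧
      ∀ x, ‖gradient ψ x - gradient φ x‖ ≤ ε := by
  obtain ⟨δ₀, hδ₀, hδU⟩ := hc.isCompact.exists_cthickening_subset_open hU hs
  refine ⟨cthickening δ₀ (tsupport φ), hc.isCompact.cthickening, hδU,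
    self_subset_cthickening _, fun ε hε => ?_⟩
  have hcd : HasCompactSupport (fderiv ℝ φ) := hc.fderiv ℝ
  have hφ' := hφ.continuous_fderiv one_ne_zero
  obtain ⟨δ₁, hδ₁, h1⟩ := Metric.uniformContinuous_iff.1
    (hc.uniformContinuous_of_continuous hφ.continuous) ε hε
  obtain ⟨δ₂, hδ₂, h2⟩ := Metric.uniformContinuous_iff.1
    (hcd.uniformContinuous_of_continuous hφ') ε hε
  set δ := min δ₀ (min δ₁ δ₂)
  have hδ : 0 < δ := by positivity
  let f : ContDiffBump (0 : E) := ⟨δ / 2, δ, by positivity, by linarith⟩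
  set ψ : E → ℝ := f.normed μ ⋆[ContinuousLinearMap.lsmul ℝ ℝ, μ] φ
  have hd : ∀ x, HasFDerivAt ψ
      ((f.normed μ ⋆[ContinuousLinearMap.lsmul ℝ ℝ, μ] fderiv ℝ φ : E → E →L[ℝ] ℝ) x) x := by
    intro x
    have := hc.hasFDerivAt_convolution_right (μ := μ) (ContinuousLinearMap.lsmul ℝ ℝ)
      (f.continuous_normed (μ := μ)).locallyIntegrable hφ x
    have e : ((f.normed μ) ⋆[(ContinuousLinearMap.lsmul ℝ ℝ : ℝ →L[ℝ] ℝ →L[ℝ] ℝ).precompR E, μ]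
        fderiv ℝ φ) x =
        (f.normed μ ⋆[ContinuousLinearMap.lsmul ℝ ℝ, μ] fderiv ℝ φ : E → E →L[ℝ] ℝ) x := by
      refine integral_congr_ae (ae_of_all _ fun t => ?_)
      ext v
      simp
    exact e ▸ this
  refine ⟨ψ, ?_, ?_, ?_, ?_, ?_⟩
  · exact f.hasCompactSupport_normed.contDiff_convolution_left _ f.contDiff_normed
      hφ.continuous.locallyIntegrable
  · refine closure_minimal ((support_convolution_subset _).trans ?_) isClosed_cthickening
    rintro _ ⟨a, ha, b, hb, rfl⟩
    rw [f.support_normed_eq, mem_ball_zero_iff] at ha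
    refine mem_cthickening_of_dist_le _ b _ _ (subset_tsupport _ hb) ?_
    simp only [dist_add_self_left]
    exact ha.le.trans (min_le_left _ _)
  · intro x
    exact integral_nonneg fun y => mul_nonneg (f.nonneg_normed y) (h0 _)
  · intro x
    rw [← Real.dist_eq]
    refine f.dist_normed_convolution_le hφ.continuous.aestronglyMeasurable fun y hy => (h1 ?_).le
    exact (mem_ball.1 hy).trans_le ((min_le_right _ _).trans (min_le_left _ _))
  · intro x
    rw [gradient, gradient, ← map_sub, LinearIsometryEquiv.norm_map, (hd x).fderiv, ← dist_eq_norm]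
    refine f.dist_normed_convolution_le hφ'.aestronglyMeasurable fun y hy => (h2 ?_).le
    exact (mem_ball.1 hy).trans_le ((min_le_right _ _).trans (min_le_right _ _))

lemma abs_integral_sub_le {μ : Measure E} [IsFiniteMeasureOnCompacts μ] {f g a : E → ℝ} {K : Set E}
    {ε : ℝ} (hK : IsCompact K) (hf : Integrable f μ) (hg : Integrable g μ)
    (ha : ContinuousOn a K) (h0 : ∀ x ∉ K, f x = g x) (h : ∀ x ∈ K, |f x - g x| ≤ a x * ε) :
    |∫ x, f x ∂μ - ∫ x, g x ∂μ| ≤ (∫ x in K, a x ∂μ) * ε := by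
  rw [← integral_sub hf hg, ← setIntegral_eq_integral_of_forall_compl_eq_zero (s := K)
    fun x hx => sub_eq_zero.2 (h0 x hx), ← integral_mul_const]
  exact (norm_integral_le_integral_norm _).trans <| setIntegral_mono_on
    (hf.sub hg).norm.integrableOn ((ha.integrableOn_compact hK).mul_const _) hK.measurableSet h

lemma integrable_flux {μ : Measure E} [IsFiniteMeasureOnCompacts μ] {p : ℝ} (hp : 1 < p)
    {w φ : E → ℝ} {U K : Set E} (hU : IsOpen U) (hw : ContDiffOn ℝ 1 w U) (hφ : ContDiff ℝ 1 φ)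
    (hK : IsCompact K) (hs : tsupport φ ⊆ K) (hKU : K ⊆ U) :
    Integrable (fun x => ‖gradient w x‖ ^ (p - 2) * ⟪gradient w x, gradient φ x⟫) μ :=
  integrable_of_continuousOn_compact hK ((continuous_flux hp).comp_continuousOn
    (((hw.continuousOn_gradient hU).mono hKU).prodMk hφ.continuous_gradient.continuousOn))
    fun x hx => by simp [gradient_of_notMem_tsupport fun h => hx (hs h)]

lemma rpow_sub_two_mul_self {p t : ℝ} (hp : 1 < p) (ht : 0 ≤ t) :
    t ^ (p - 2) * t = t ^ (p - 1) := by
  rw [← Real.rpow_add_one' ht (by linarith)]; ring_nf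

open scoped ContDiff in
lemma halfSol_of_smooth {μ : Measure E} [μ.IsAddHaarMeasure] {p σ Λ : ℝ} {U : Set E}
    {w : E → ℝ} (hp : 1 < p) (hU : IsOpen U) (hw : ContDiffOn ℝ 1 w U) (hpos : ∀ x ∈ U, 0 < w x)
    (h : ∀ φ : E → ℝ, ContDiff ℝ ∞ φ → HasCompactSupport φ → tsupport φ ⊆ U → (∀ x, 0 ≤ φ x) →
      σ * ∫ x, ‖gradient w x‖ ^ (p - 2) * ⟪gradient w x, gradient φ x⟫ ∂μ ≤
        Λ * ∫ x, w x ^ (p - 1) * φ x ∂μ) : HalfSol μ p σ Λ U w := by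
  intro φ hφ hc hs h0
  obtain ⟨K, hK, hKU, hφK, hK'⟩ := exists_smooth_approx μ hφ hc hU hs h0
  set A := ∫ x in K, ‖gradient w x‖ ^ (p - 1) ∂μ
  set B := ∫ x in K, w x ^ (p - 1) ∂μ
  have hgw := (hw.continuousOn_gradient hU).mono hKU
  have hA : 0 ≤ A := integral_nonneg fun x => by positivity
  have hB : 0 ≤ B := setIntegral_nonneg hK.measurableSet fun x hx =>
    Real.rpow_nonneg (hpos x (hKU hx)).le _
  refine le_of_forall_pos_le_add fun η hη => ?_
  have hM : 0 < |σ| * A + |Λ| * B + 1 := by positivity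
  obtain ⟨ψ, hψ, hψK, hψ0, h1, h2⟩ := hK' (η / (|σ| * A + |Λ| * B + 1)) (by positivity)
  set ε := η / (|σ| * A + |Λ| * B + 1) with hε
  have hεM : ε * (|σ| * A + |Λ| * B + 1) = η := div_mul_cancel₀ _ hM.ne'
  have hε0 : 0 < ε := by positivity
  have hψ1 : ContDiff ℝ 1 ψ := hψ.of_le (by simp)
  have hψc : HasCompactSupport ψ := hK.of_isClosed_subset (isClosed_tsupport _) hψK
  have key := h ψ hψ hψc (hψK.trans hKU) hψ0
  have e1 := abs_integral_sub_le (μ := μ) (ε := ε) (a := fun x => ‖gradient w x‖ ^ (p - 1)) hK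
    (integrable_flux hp hU hw hψ1 hK hψK hKU) (integrable_flux hp hU hw hφ hK hφK hKU)
    (hgw.norm.rpow_const fun x _ => Or.inr (by linarith))
    (fun x hx => by simp [gradient_of_notMem_tsupport fun h => hx (hψK h),
      gradient_of_notMem_tsupport fun h => hx (hφK h)])
    (fun x _ => by
      rw [← mul_sub, ← inner_sub_right, abs_mul, abs_of_nonneg (by positivity),
        ← rpow_sub_two_mul_self hp (norm_nonneg _), mul_assoc]
      gcongr
      exact (abs_real_inner_le_norm _ _).trans (mul_le_mul_of_nonneg_left (h2 x) (norm_nonneg _)))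
  have e2 := abs_integral_sub_le (μ := μ) (ε := ε) (a := fun x => w x ^ (p - 1)) hK
    (integrable_rpow_mul (q := p - 1) hw.continuousOn hpos hψ1.continuous hψc (hψK.trans hKU))
    (integrable_rpow_mul (q := p - 1) hw.continuousOn hpos hφ.continuous hc hs)
    ((hw.continuousOn.mono hKU).rpow_const fun x hx => Or.inl (hpos x (hKU hx)).ne')
    (fun x hx => by simp [image_eq_zero_of_notMem_tsupport fun h => hx (hψK h),
      image_eq_zero_of_notMem_tsupport fun h => hx (hφK h)])
    (fun x hx => by
      have := Real.rpow_nonneg (hpos x (hKU hx)).le (p - 1)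
      rw [← mul_sub, abs_mul, abs_of_nonneg this]
      gcongr
      exact h1 x)
  set F := ∫ x, ‖gradient w x‖ ^ (p - 2) * ⟪gradient w x, gradient φ x⟫ ∂μ
  set F' := ∫ x, ‖gradient w x‖ ^ (p - 2) * ⟪gradient w x, gradient ψ x⟫ ∂μ
  set H := ∫ x, w x ^ (p - 1) * φ x ∂μ
  set H' := ∫ x, w x ^ (p - 1) * ψ x ∂μ
  have e3 : |σ * F' - σ * F| ≤ |σ| * (A * ε) := by
    rw [← mul_sub, abs_mul]; gcongr
  have e4 : |Λ * H' - Λ * H| ≤ |Λ| * (B * ε) := by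
    rw [← mul_sub, abs_mul]; gcongr
  have := (abs_le.1 e3).1
  have := (abs_le.1 e4).2
  nlinarith

end SmoothTest

section MaximumPrinciple

variable {E : Type*} [NormedAddCommGroup E] [InnerProductSpace ℝ E] [FiniteDimensional ℝ E]
  [MeasurableSpace E] [BorelSpace E]

/-- A `C¹` subsolution of the `p`-Laplace equation that is strictly below `c` outside the interior of
a compact set is at most `c` inside. -/
lemma HalfSol.le_of_compact {μ : Measure E} [μ.IsAddHaarMeasure] {p c : ℝ} {U K : Set E} {u : E → ℝ}
    (hp : 1 < p) (hU : IsOpen U) (hu : ContDiffOn ℝ 1 u U) (h : HalfSol μ p 1 0 U u)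
    (hK : IsCompact K) (hKU : K ⊆ U) (hKne : Kᶜ.Nonempty)
    (hbd : ∀ x ∈ K, x ∉ interior K → u x < c) : ∀ x ∈ K, u x ≤ c := by
  classical
  set S := K ∩ u ⁻¹' Ici c with hS
  have hSc : IsClosed S := (hu.continuousOn.mono hKU).preimage_isClosed_of_isClosed hK.isClosed
    isClosed_Ici
  have hSK : S ⊆ interior K := fun x hx => by
    by_contra hn
    exact absurd (hbd x hx.1 hn) (not_lt.2 hx.2)
  set g : E → ℝ := fun x => expNegInvGlue (u x - c) with hg
  set φ : E → ℝ := K.indicator g with hφdef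
  have hφS : ∀ x ∉ S, φ x = 0 := fun x hx => by
    by_cases hxK : x ∈ K
    · have : u x < c := not_le.1 fun hc => hx ⟨hxK, hc⟩
      simp only [hφdef, indicator_of_mem hxK, hg]
      exact expNegInvGlue.zero_of_nonpos (by linarith)
    · simp [hφdef, hxK]
  have hts : tsupport φ ⊆ S := closure_minimal (fun x hx => by
    by_contra hn; exact hx (hφS x hn)) hSc
  have hloc : ∀ x ∈ interior K, φ =ᶠ[𝓝 x] g := fun x hx => by
    filter_upwards [mem_interior_iff_mem_nhds.1 hx] with y hy
    simp [hφdef, hy]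
  have hglue : ContDiff ℝ 1 expNegInvGlue := expNegInvGlue.contDiff (n := 1)
  have huat : ∀ x ∈ K, ContDiffAt ℝ 1 u x := fun x hx => hu.contDiffAt (hU.mem_nhds (hKU hx))
  have hφ : ContDiff ℝ 1 φ := by
    rw [contDiff_iff_contDiffAt]
    intro x
    by_cases hx : x ∈ S
    · exact (hglue.contDiffAt.comp x ((huat x hx.1).sub contDiffAt_const)).congr_of_eventuallyEq
        (hloc x (hSK hx))
    · have : φ =ᶠ[𝓝 x] fun _ => 0 := by
        filter_upwards [hSc.isOpen_compl.mem_nhds hx] with y hy using hφS y hy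
      exact contDiffAt_const.congr_of_eventuallyEq this
  have hφ0 : ∀ x, 0 ≤ φ x := fun x => indicator_nonneg (fun y _ => expNegInvGlue.nonneg _) x
  have hφc : HasCompactSupport φ :=
    hK.of_isClosed_subset (isClosed_tsupport _) (hts.trans inter_subset_left)
  have hgrad : ∀ x ∈ S, gradient φ x = deriv expNegInvGlue (u x - c) • gradient u x := by
    intro x hx
    have h1 : HasFDerivAt g (deriv expNegInvGlue (u x - c) • fderiv ℝ u x) x :=
      ((hglue.differentiable one_ne_zero _).hasDerivAt).comp_hasFDerivAt x
        (((huat x hx.1).differentiableAt one_ne_zero).hasFDerivAt.sub_const c)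
    have h2 := h1.congr_of_eventuallyEq (hloc x (hSK hx))
    rw [gradient, h2.fderiv, map_smulₛₗ]
    rfl
  have hd0 : ∀ t, 0 ≤ deriv expNegInvGlue t := fun t => expNegInvGlue.monotone.deriv_nonneg
  have hflux : ∀ x, ‖gradient u x‖ ^ (p - 2) * ⟪gradient u x, gradient φ x⟫ =
      if x ∈ S then deriv expNegInvGlue (u x - c) * (‖gradient u x‖ ^ (p - 2) * ‖gradient u x‖ ^ 2)
        else 0 := by
    intro x
    split_ifs with hx
    · rw [hgrad x hx, real_inner_smul_right, real_inner_self_eq_norm_sq]; ring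
    · simp [gradient_of_notMem_tsupport fun h => hx (hts h)]
  have hnn : ∀ x, 0 ≤ ‖gradient u x‖ ^ (p - 2) * ⟪gradient u x, gradient φ x⟫ := fun x => by
    rw [hflux]
    split_ifs
    · exact mul_nonneg (hd0 _) (by positivity)
    · exact le_rfl
  have hint := integrable_flux (μ := μ) hp hU hu hφ hK (hts.trans inter_subset_left) hKU
  have key := h φ hφ hφc ((hts.trans inter_subset_left).trans hKU) hφ0
  rw [one_mul, zero_mul] at key
  have hae := (integral_eq_zero_iff_of_nonneg hnn hint).1 (le_antisymm key (integral_nonneg hnn))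
  have hg0 : gradient φ =ᵐ[μ] fun _ => 0 := by
    filter_upwards [hae] with x hx
    by_cases hxS : x ∈ S
    · rw [hflux, if_pos hxS, Pi.zero_apply] at hx
      rw [hgrad x hxS]
      by_contra hne
      obtain ⟨h1, h2⟩ := smul_ne_zero_iff.1 hne
      have := norm_pos_iff.2 h2
      exact (mul_pos ((hd0 _).lt_of_ne' h1) (by positivity)).ne' hx
    · exact gradient_of_notMem_tsupport fun h => hxS (hts h)
  have hg1 := (Continuous.ae_eq_iff_eq μ hφ.continuous_gradient continuous_const).1 hg0
  have hconst := is_const_of_fderiv_eq_zero (𝕜 := ℝ) (hφ.differentiable one_ne_zero) fun x => by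
    rw [← norm_eq_zero, ← norm_gradient, hg1, norm_zero]
  obtain ⟨z, hz⟩ := hKne
  intro x hx
  have h1 : φ x = 0 := (hconst x z).trans (indicator_of_notMem hz _)
  rw [hφdef, indicator_of_mem hx] at h1
  have := expNegInvGlue.zero_iff_nonpos.1 h1
  linarith

lemma HalfSol.le_of_annulus {μ : Measure E} [μ.IsAddHaarMeasure] {p c a b : ℝ} {U : Set E}
    {u : E → ℝ} (hp : 1 < p) (hU : IsOpen U) (hu : ContDiffOn ℝ 1 u U) (h : HalfSol μ p 1 0 U u)
    (ha : 0 < a) (hsub : {x | a ≤ ‖x‖} ⊆ U) (h1 : ∀ x, ‖x‖ = a → u x < c)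
    (h2 : ∀ x, ‖x‖ = b → u x < c) : ∀ x, a ≤ ‖x‖ → ‖x‖ ≤ b → u x ≤ c := by
  set K : Set E := {x | a ≤ ‖x‖ ∧ ‖x‖ ≤ b} with hKdef
  have hKc : IsClosed K := (isClosed_le continuous_const continuous_norm).inter
    (isClosed_le continuous_norm continuous_const)
  have hK : IsCompact K := (isCompact_closedBall (0 : E) b).of_isClosed_subset hKc
    fun x hx => mem_closedBall_zero_iff.2 hx.2
  have := h.le_of_compact hp hU hu hK (fun x hx => hsub hx.1)
    ⟨0, fun h0 => absurd h0.1 (by simpa using ha)⟩ (c := c) (fun x hx hn => by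
      by_contra hc
      have ha' : a < ‖x‖ := hx.1.lt_of_ne' fun e => hc (h1 x e)
      have hb' : ‖x‖ < b := hx.2.lt_of_ne fun e => hc (h2 x e)
      refine hn (interior_maximal (s := K) (t := {x | a < ‖x‖ ∧ ‖x‖ < b})
        (fun y hy => ⟨hy.1.le, hy.2.le⟩) ?_ ⟨ha', hb'⟩)
      exact (isOpen_lt continuous_const continuous_norm).inter
        (isOpen_lt continuous_norm continuous_const))
  exact fun x hxa hxb => this x ⟨hxa, hxb⟩

end MaximumPrinciple

section Spheres

variable {E : Type*} [NormedAddCommGroup E] [InnerProductSpace ℝ E] [FiniteDimensional ℝ E]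

lemma exists_unit_orthogonal (hE : 2 ≤ Module.finrank ℝ E) (x : E) :
    ∃ e : E, ‖e‖ = 1 ∧ ⟪x, e⟫ = 0 := by
  have hne : (Submodule.span ℝ {x})ᗮ ≠ ⊥ := fun h => by
    have h1 := Submodule.orthogonal_eq_bot_iff.1 h
    have h2 := finrank_span_le_card (R := ℝ) ({x} : Set E)
    rw [h1, finrank_top] at h2
    simp at h2
    omega
  obtain ⟨v, hv, hv0⟩ := Submodule.exists_mem_ne_zero_of_ne_bot hne
  refine ⟨‖v‖⁻¹ • v, by simp [norm_smul, hv0], ?_⟩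
  rw [real_inner_smul_right, Submodule.mem_orthogonal_singleton_iff_inner_right.1 hv, mul_zero]

lemma exists_eq_cos_smul_add_sin_smul (hE : 2 ≤ Module.finrank ℝ E) {x y : E} {r : ℝ} (hr : 0 < r)
    (hx : ‖x‖ = r) (hy : ‖y‖ = r) :
    ∃ e : E, ∃ α, ‖e‖ = r ∧ ⟪x, e⟫ = 0 ∧ 0 ≤ α ∧ α ≤ Real.pi ∧
      y = Real.cos α • x + Real.sin α • e := by
  set c := ⟪x, y⟫ / r ^ 2 with hc
  have hcr : c * r ^ 2 = ⟪x, y⟫ := by rw [hc]; field_simp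
  have hxy := abs_le.1 (abs_real_inner_le_norm x y)
  rw [hx, hy] at hxy
  have hc1 : -1 ≤ c := by rw [hc, le_div_iff₀ (by positivity)]; nlinarith
  have hc2 : c ≤ 1 := by rw [hc, div_le_iff₀ (by positivity)]; nlinarith
  set w := y - c • x with hw
  have hxw : ⟪x, w⟫ = 0 := by
    rw [hw, inner_sub_right, real_inner_smul_right, real_inner_self_eq_norm_sq, hx]; linarith
  have hwn : ‖w‖ = √(1 - c ^ 2) * r := by
    have h1 : ‖w‖ ^ 2 = (1 - c ^ 2) * r ^ 2 := by
      rw [hw, norm_sub_sq_real, norm_smul, mul_pow, hx, hy, real_inner_smul_right,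
        real_inner_comm, ← hcr, Real.norm_eq_abs, sq_abs]
      ring
    rw [← Real.sqrt_sq (norm_nonneg w), h1, Real.sqrt_mul (by nlinarith), Real.sqrt_sq hr.le]
  have hcos := Real.cos_arccos hc1 hc2
  by_cases hw0 : w = 0
  · obtain ⟨e, he, hxe⟩ := exists_unit_orthogonal hE x
    refine ⟨r • e, Real.arccos c, ?_, ?_, Real.arccos_nonneg _, Real.arccos_le_pi _, ?_⟩
    · rw [norm_smul, he, mul_one, Real.norm_of_nonneg hr.le]
    · rw [real_inner_smul_right, hxe, mul_zero]
    · have : √(1 - c ^ 2) = 0 := by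
        rw [hw0, norm_zero] at hwn
        simpa [hr.ne'] using hwn.symm
      rw [hcos, Real.sin_arccos, this, zero_smul, add_zero]
      exact sub_eq_zero.1 hw0
  · have hwpos := norm_pos_iff.2 hw0
    have hs : √(1 - c ^ 2) ≠ 0 := fun h => by rw [hwn, h, zero_mul] at hwpos; exact hwpos.ne rfl
    refine ⟨(√(1 - c ^ 2))⁻¹ • w, Real.arccos c, ?_, ?_, Real.arccos_nonneg _,
      Real.arccos_le_pi _, ?_⟩
    · rw [norm_smul, hwn, Real.norm_of_nonneg (by positivity), ← mul_assoc, inv_mul_cancel₀ hs,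
        one_mul]
    · rw [real_inner_smul_right, hxw, mul_zero]
    · rw [hcos, Real.sin_arccos, smul_smul, mul_inv_cancel₀ hs, one_smul, hw]
      abel

/-- Points of a sphere are joined by chains of boundedly many small steps. -/
lemma exists_chain (hE : 2 ≤ Module.finrank ℝ E) {θ : ℝ} (hθ : 0 < θ) :
    ∃ N : ℕ, ∀ r > 0, ∀ x y : E, ‖x‖ = r → ‖y‖ = r → ∃ z : ℕ → E, z 0 = x ∧ z N = y ∧
      ∀ i, ‖z i‖ = r ∧ ‖z (i + 1) - z i‖ ≤ θ * r := by
  obtain ⟨N, hN⟩ := exists_nat_gt (2 * Real.pi / θ)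
  have hN0 : (0 : ℝ) < N := (by positivity : 0 < 2 * Real.pi / θ).trans hN
  refine ⟨N, fun r hr x y hx hy => ?_⟩
  obtain ⟨e, α, he, hxe, hα0, hαπ, rfl⟩ := exists_eq_cos_smul_add_sin_smul hE hr hx hy
  refine ⟨fun i => Real.cos (i * (α / N)) • x + Real.sin (i * (α / N)) • e, by simp, ?_,
    fun i => ⟨?_, ?_⟩⟩
  · simp only [mul_div_cancel₀ α hN0.ne']
  · rw [← sq_eq_sq₀ (norm_nonneg _) hr.le, norm_add_sq_real, real_inner_smul_left,
      real_inner_smul_right, hxe, norm_smul, norm_smul, mul_pow, mul_pow, he, hx,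
      Real.norm_eq_abs, Real.norm_eq_abs, sq_abs, sq_abs]
    linear_combination r ^ 2 * Real.cos_sq_add_sin_sq (i * (α / N))
  · have e1 : ((i + 1 : ℕ) : ℝ) * (α / N) - i * (α / N) = α / N := by push_cast; ring
    have h1 := Real.abs_cos_sub_cos_le ((i + 1 : ℕ) * (α / N)) (i * (α / N))
    have h2 := Real.abs_sin_sub_sin_le ((i + 1 : ℕ) * (α / N)) (i * (α / N))
    rw [e1, abs_of_nonneg (div_nonneg hα0 hN0.le)] at h1 h2
    have h3 : 2 * (α / N) ≤ θ := by
      rw [div_lt_iff₀ hθ] at hN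
      rw [← mul_div_assoc, div_le_iff₀ hN0]
      linarith
    have e2 : ∀ a b a' b' : ℝ, (a • x + b • e) - (a' • x + b' • e) = (a - a') • x + (b - b') • e :=
      fun a b a' b' => by simp only [sub_smul]; abel
    rw [e2]
    refine (norm_add_le _ _).trans ?_
    rw [norm_smul, norm_smul, hx, he, ← add_mul, Real.norm_eq_abs, Real.norm_eq_abs]
    gcongr
    linarith

end Spheres

section Exterior

variable {E : Type*} [NormedAddCommGroup E] [InnerProductSpace ℝ E] [FiniteDimensional ℝ E]
  [MeasurableSpace E] [BorelSpace E]

lemma ball_subset_setOf_lt_norm {x : E} {a r t : ℝ} (hx : ‖x‖ = r) (ht : a + t ≤ r) :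
    ball x t ⊆ {z : E | a < ‖z‖} := fun z hz => by
  have h1 := norm_sub_norm_le x z
  rw [mem_ball, dist_comm, dist_eq_norm] at hz
  show a < ‖z‖
  linarith

lemma isOpen_setOf_lt_norm (a : ℝ) : IsOpen {x : E | a < ‖x‖} :=
  isOpen_lt continuous_const continuous_norm

lemma ContDiffOn.comp_add_smul_ball {u : E → ℝ} {U : Set E} {x₀ : E} {s t : ℝ}
    (hu : ContDiffOn ℝ 1 u U) (hs : 0 < s) (h : ball x₀ (t * s) ⊆ U) :
    ContDiffOn ℝ 1 (fun y => u (x₀ + s • y)) (ball 0 t) :=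
  hu.comp (by fun_prop) fun y hy => h (by
    rw [mem_ball_zero_iff] at hy
    rw [mem_ball_iff_norm, add_sub_cancel_left, norm_smul, Real.norm_of_nonneg hs.le, mul_comm]
    gcongr)

lemma forall_ball_comp_add_smul {P : E → Prop} {x₀ : E} {s t : ℝ} (hs : 0 < s)
    (h : ∀ x ∈ ball x₀ (t * s), P x) : ∀ y ∈ ball (0 : E) t, P (x₀ + s • y) :=
  fun y hy => h _ (by
    rw [mem_ball_zero_iff] at hy
    rw [mem_ball_iff_norm, add_sub_cancel_left, norm_smul, Real.norm_of_nonneg hs.le, mul_comm]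
    gcongr)

lemma exists_eq_add_smul_of_mem_closedBall {x₀ x : E} {s t : ℝ} (hs : 0 < s)
    (hx : x ∈ closedBall x₀ (t * s)) : ∃ y ∈ closedBall (0 : E) t, x = x₀ + s • y := by
  refine ⟨s⁻¹ • (x - x₀), ?_, by simp [smul_smul, hs.ne']⟩
  rw [mem_closedBall_iff_norm] at hx
  rw [mem_closedBall_zero_iff, norm_smul, Real.norm_of_nonneg (by positivity), inv_mul_le_iff₀ hs]
  linarith

/-- The Harnack inequality for scaled balls. -/
lemma exists_harnack_scaled (μ : Measure E) [μ.IsAddHaarMeasure] {p Λ : ℝ} (hp : 1 < p)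
    (hΛ : 0 ≤ Λ) (hE : 2 ≤ Module.finrank ℝ E) :
    ∃ K, 0 < K ∧ ∀ (u : E → ℝ) (U : Set E) (x₀ : E) (s Λ₁ Λ₂ : ℝ), 0 < s → ball x₀ (2 * s) ⊆ U →
      ContDiffOn ℝ 1 u U → (∀ x ∈ U, 0 < u x) → HalfSol μ p (-1) Λ₁ U u → HalfSol μ p 1 Λ₂ U u →
      s ^ p * Λ₁ ≤ Λ → s ^ p * Λ₂ ≤ Λ → ∀ y ∈ closedBall x₀ (1 / 2 * s), u x₀ ≤ K * u y := by
  obtain ⟨K, hK, h⟩ := exists_harnack μ hp hΛ hE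
  refine ⟨K, hK, fun u U x₀ s Λ₁ Λ₂ hs hU hu hpos h1 h2 hΛ₁ hΛ₂ y hy => ?_⟩
  obtain ⟨y, hy', rfl⟩ := exists_eq_add_smul_of_mem_closedBall hs hy
  have hpos' := forall_ball_comp_add_smul hs fun x hx => hpos x (hU hx)
  simpa using h (fun y => u (x₀ + s • y)) (hu.comp_add_smul_ball hs hU) hpos'
    ((h1.scale hs hU).mono subset_rfl hΛ₁ fun x hx => (hpos' x hx).le)
    ((h2.scale hs hU).mono subset_rfl hΛ₂ fun x hx => (hpos' x hx).le) 0 (by simp) y hy'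

lemma exists_small_in_ball_scaled (μ : Measure E) [μ.IsAddHaarMeasure] {p ρ δ : ℝ} (hp : 1 < p)
    (hE : 2 ≤ Module.finrank ℝ E) (hρ : 0 < ρ) (hδ : 0 < δ) :
    ∃ ε, 0 < ε ∧ ∀ (w : E → ℝ) (U : Set E) (x₀ : E) (s : ℝ), 0 < s → ball x₀ (2 * s) ⊆ U →
      ContDiffOn ℝ 1 w U → (∀ x ∈ U, 0 < w x) → HalfSol μ p (-1) 0 U w →
      (∃ x ∈ closedBall x₀ (1 / 2 * s), w x ≤ ε) →
      ∀ z ∈ closedBall x₀ (1 / 2 * s), ∃ y ∈ ball z (ρ * s), w y ≤ δ := by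
  obtain ⟨ε, hε, h⟩ := exists_small_in_ball μ hp le_rfl hE hρ hδ
  refine ⟨ε, hε, fun w U x₀ s hs hU hw hpos h1 ⟨x, hx, hxε⟩ z hz => ?_⟩
  obtain ⟨x, hx', rfl⟩ := exists_eq_add_smul_of_mem_closedBall hs hx
  obtain ⟨z, hz', rfl⟩ := exists_eq_add_smul_of_mem_closedBall hs hz
  have h1' := h1.scale hs hU
  rw [mul_zero] at h1'
  obtain ⟨y, hy, hyδ⟩ := h (fun y => w (x₀ + s • y)) (hw.comp_add_smul_ball hs hU)
    (forall_ball_comp_add_smul hs fun x hx => hpos x (hU hx)) h1' ⟨x, hx', hxε⟩ z hz'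
  refine ⟨x₀ + s • y, ?_, hyδ⟩
  rw [mem_ball_iff_norm] at hy ⊢
  rw [add_sub_add_left_eq_sub, ← smul_sub, norm_smul, Real.norm_of_nonneg hs.le, mul_comm]
  gcongr

/-- The Harnack inequality on spheres for Fuchsian potentials. -/
lemma exists_harnack_sphere (μ : Measure E) [μ.IsAddHaarMeasure] {p C R₀ : ℝ} {u : E → ℝ}
    (hp : 1 < p) (hC : 0 ≤ C) (hE : 2 ≤ Module.finrank ℝ E) (hR₀ : 0 < R₀)
    (hu : ContDiffOn ℝ 1 u {x | R₀ < ‖x‖}) (hpos : ∀ x, R₀ < ‖x‖ → 0 < u x)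
    (hsub : HalfSol μ p 1 0 {x | R₀ < ‖x‖} u)
    (hsup : ∀ a, R₀ ≤ a → HalfSol μ p (-1) (C / a ^ p) {x | a < ‖x‖} u) :
    ∃ K, 0 < K ∧ ∀ r, 2 * R₀ ≤ r → ∀ x y : E, ‖x‖ = r → ‖y‖ = r → u x ≤ K * u y := by
  obtain ⟨K, hK, h⟩ := exists_harnack_scaled μ hp hC hE
  obtain ⟨N, hN⟩ := exists_chain hE (by norm_num : (0 : ℝ) < 1 / 8)
  refine ⟨K ^ N, by positivity, fun r hr x y hx hy => ?_⟩
  have hr0 : 0 < r := by linarith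
  obtain ⟨z, rfl, rfl, hz⟩ := hN r hr0 x y hx hy
  have hstep : ∀ i, u (z i) ≤ K * u (z (i + 1)) := fun i => by
    have hsubset : {x : E | r / 2 < ‖x‖} ⊆ {x | R₀ < ‖x‖} := fun x hx => by
      simp only [mem_ofPred_eq] at hx ⊢; linarith
    refine h u {x | r / 2 < ‖x‖} (z i) (r / 4) (C / (r / 2) ^ p) 0 (by positivity)
      (ball_subset_setOf_lt_norm (hz i).1 (by linarith)) (hu.mono hsubset)
      (fun x hx => hpos x (hsubset hx)) (hsup _ (by linarith))
      (hsub.mono hsubset le_rfl fun x hx => (hpos x (hsubset hx)).le) ?_ (by simpa) _ ?_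
    · rw [mul_div_left_comm, ← Real.div_rpow (by positivity) (by positivity)]
      refine mul_le_of_le_one_right hC (Real.rpow_le_one (by positivity) ?_ (by linarith))
      rw [div_le_one (by positivity)]; linarith
    · rw [mem_closedBall_iff_norm]
      linarith [(hz i).2]
  have hind : ∀ n, u (z 0) ≤ K ^ n * u (z n) := fun n => by
    induction n with
    | zero => simp
    | succ n ih =>
      refine ih.trans ?_
      rw [pow_succ, mul_assoc]
      exact mul_le_mul_of_nonneg_left (hstep n) (by positivity)
  exact hind N

lemma exists_small_near_sphere (μ : Measure E) [μ.IsAddHaarMeasure] {p ρ δ : ℝ} (hp : 1 < p)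
    (hE : 2 ≤ Module.finrank ℝ E) (hρ : 0 < ρ) (hρ' : ρ ≤ 1 / 2) (hδ : 0 < δ) :
    ∃ ε, 0 < ε ∧ ∀ (w : E → ℝ) (r : ℝ), 0 < r → ContDiffOn ℝ 1 w {x | r / 2 < ‖x‖} →
      (∀ x, r / 2 < ‖x‖ → 0 < w x) → HalfSol μ p (-1) 0 {x | r / 2 < ‖x‖} w →
      (∃ x, ‖x‖ = r ∧ w x ≤ ε) → ∀ y, ‖y‖ = r → ∃ z ∈ ball y (ρ * (r / 4)), w z ≤ δ := by
  obtain ⟨N, hN⟩ := exists_chain hE (by norm_num : (0 : ℝ) < 1 / 8)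
  have hind : ∀ n : ℕ, ∀ δ : ℝ, 0 < δ → ∃ ε, 0 < ε ∧ ∀ (w : E → ℝ) (r : ℝ), 0 < r →
      ContDiffOn ℝ 1 w {x | r / 2 < ‖x‖} →
      (∀ x, r / 2 < ‖x‖ → 0 < w x) → HalfSol μ p (-1) 0 {x | r / 2 < ‖x‖} w →
      ∀ z : ℕ → E, (∀ i, ‖z i‖ = r ∧ ‖z (i + 1) - z i‖ ≤ 1 / 8 * r) → w (z 0) ≤ ε →
      ∃ y ∈ ball (z n) (ρ * (r / 4)), w y ≤ δ := by
    intro n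
    induction n with
    | zero =>
      exact fun δ hδ => ⟨δ, hδ, fun w r hr _ _ _ z _ h0 => ⟨z 0, by simp; positivity, h0⟩⟩
    | succ n ih =>
      intro δ hδ
      obtain ⟨ε₁, hε₁, h1⟩ := exists_small_in_ball_scaled μ hp hE hρ hδ
      obtain ⟨ε, hε, h⟩ := ih ε₁ hε₁
      refine ⟨ε, hε, fun w r hr hw hpos hsup z hz h0 => ?_⟩
      obtain ⟨y, hy, hyε⟩ := h w r hr hw hpos hsup z hz h0
      refine h1 w _ (z n) (r / 4) (by positivity)
        (ball_subset_setOf_lt_norm (hz n).1 (by linarith)) hw hpos hsup ⟨y, ?_, hyε⟩ _ ?_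
      · exact closedBall_subset_closedBall (by gcongr) (ball_subset_closedBall hy)
      · rw [mem_closedBall_iff_norm]
        linarith [(hz n).2]
  obtain ⟨ε, hε, h⟩ := hind N δ hδ
  refine ⟨ε, hε, fun w r hr hw hpos hsup ⟨x, hx, hxε⟩ y hy => ?_⟩
  obtain ⟨z, rfl, rfl, hz⟩ := hN r hr x y hx hy
  exact h w r hr hw hpos hsup z hz hxε

/-- Either large values occur on all large spheres, or the subsolution is eventually bounded. -/
lemma HalfSol.exists_sphere_or_bounded {μ : Measure E} [μ.IsAddHaarMeasure] {p R₀ : ℝ} {u : E → ℝ}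
    (hp : 1 < p) (hR₀ : 0 < R₀) (hu : ContDiffOn ℝ 1 u {x | R₀ < ‖x‖})
    (hsub : HalfSol μ p 1 0 {x | R₀ < ‖x‖} u) (c : ℝ) :
    (∃ a, ∀ r, a ≤ r → ∃ x, ‖x‖ = r ∧ c ≤ u x) ∨ ∃ a, ∀ x, a ≤ ‖x‖ → u x ≤ c := by
  by_contra! hcon
  obtain ⟨hn, hb⟩ := hcon
  obtain ⟨r₀, hr₀, h0⟩ := hn (R₀ + 1)
  obtain ⟨x, hx, hxc⟩ := hb r₀
  obtain ⟨r₁, hr₁, h1⟩ := hn ‖x‖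
  have := hsub.le_of_annulus hp (isOpen_setOf_lt_norm R₀) hu (by linarith)
    (fun y (hy : r₀ ≤ ‖y‖) => show R₀ < ‖y‖ by linarith) h0 h1 x hx hr₁
  linarith

/-- The lower bound matching an asymptotic upper bound. -/
lemma eventually_le_of_limsup (μ : Measure E) [μ.IsAddHaarMeasure] {p C R₀ L : ℝ} {u : E → ℝ}
    (hp : 1 < p) (hC : 0 ≤ C) (hE : 2 ≤ Module.finrank ℝ E) (hR₀ : 0 < R₀) (hL : 0 ≤ L)
    (hu : ContDiffOn ℝ 1 u {x | R₀ < ‖x‖}) (hpos : ∀ x, R₀ < ‖x‖ → 0 < u x)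
    (hsub : HalfSol μ p 1 0 {x | R₀ < ‖x‖} u)
    (hsup : ∀ a, R₀ ≤ a → HalfSol μ p (-1) (C / a ^ p) {x | a < ‖x‖} u)
    (hupper : ∀ η > 0, ∃ a, ∀ x, a ≤ ‖x‖ → u x < L + η)
    (hlower : ∀ η > 0, ∃ a, ∀ r, a ≤ r → ∃ x, ‖x‖ = r ∧ L - η ≤ u x) {τ : ℝ} (hτ : 0 < τ) :
    ∃ a, ∀ x, a ≤ ‖x‖ → L - τ ≤ u x := by
  set Λ := C * (L + 1) ^ (p - 1) with hΛdef
  have hΛ : 0 ≤ Λ := by positivity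
  obtain ⟨K, hK, harn⟩ := exists_harnack_scaled μ hp hΛ hE
  set ρ := min (1 / 2) (τ / (2 * K)) with hρdef
  have hρ : 0 < ρ := by positivity
  have hρ1 : ρ ≤ 1 / 2 := min_le_left _ _
  have hρK : K * (2 * ρ) ≤ τ := by
    have := min_le_right (1 / 2) (τ / (2 * K))
    rw [le_div_iff₀ (by positivity)] at this
    linarith
  obtain ⟨ε, hε, hsmall⟩ := exists_small_near_sphere μ hp hE hρ hρ1 hρ
  set η := min 1 (ε / 2) with hηdef
  have hη : 0 < η := by positivity
  have hη1 : η ≤ 1 := min_le_left _ _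
  have hηε : 2 * η ≤ ε := by linarith [min_le_right 1 (ε / 2)]
  obtain ⟨a₁, h1⟩ := hupper η hη
  obtain ⟨a₂, h2⟩ := hlower η hη
  refine ⟨max (2 * R₀) (max (2 * a₁) a₂), fun y hy => ?_⟩
  obtain ⟨hy1, hy2⟩ := max_le_iff.1 hy
  obtain ⟨hy2, hy3⟩ := max_le_iff.1 hy2
  set r := ‖y‖ with hr
  have hr0 : 0 < r := by linarith
  have hsubset : {x : E | r / 2 < ‖x‖} ⊆ {x | R₀ < ‖x‖} := fun x hx => by
    simp only [mem_ofPred_eq] at hx ⊢; linarith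
  have hu' := hu.mono hsubset
  have hlt : ∀ x : E, r / 2 < ‖x‖ → u x < L + η := fun x hx => h1 x (by linarith)
  have hsub' : HalfSol μ p 1 0 {x | r / 2 < ‖x‖} u :=
    hsub.mono hsubset le_rfl fun x hx => (hpos x (hsubset hx)).le
  obtain ⟨x, hx, hxL⟩ := h2 r hy3
  obtain ⟨z, hz, hzδ⟩ := hsmall (fun x => L + η - u x) r hr0 (contDiffOn_const.sub hu')
    (fun x hx => sub_pos.2 (hlt x hx)) (hsub'.const_sub_super _) ⟨x, hx, by linarith⟩ y rfl
  have hv : HalfSol μ p 1 (C / (r / 2) ^ p * ((L + η) / ρ) ^ (p - 1)) {x | r / 2 < ‖x‖}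
      (fun x => L + η + ρ - u x) :=
    (hsup (r / 2) (by linarith)).const_sub_sub hp (by positivity) hu'.continuousOn
      (fun x hx => hpos x (hsubset hx)) (fun x hx => (hlt x hx).le) hρ
      fun x hx => by linarith [hlt x hx]
  have hconst : (ρ * (r / 2)) ^ p * (C / (r / 2) ^ p * ((L + η) / ρ) ^ (p - 1)) ≤ Λ := by
    have e : ρ ^ p = ρ ^ (p - 1) * ρ := by
      rw [← Real.rpow_add_one hρ.ne']; ring_nf
    have hpow : (0 : ℝ) < (r / 2) ^ p := by positivity
    have hpow' : (0 : ℝ) < ρ ^ (p - 1) := by positivity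
    rw [Real.mul_rpow hρ.le (by positivity), Real.div_rpow (by positivity) hρ.le, e]
    calc _ = C * (L + η) ^ (p - 1) * ρ := by field_simp
      _ ≤ C * (L + 1) ^ (p - 1) * 1 := by
        gcongr
        linarith
      _ = Λ := mul_one _
  have key := harn (fun x => L + η + ρ - u x) {x | r / 2 < ‖x‖} y (ρ * (r / 2)) 0 _ (by positivity)
    (ball_subset_setOf_lt_norm rfl (by nlinarith)) (contDiffOn_const.sub hu')
    (fun x hx => by linarith [hlt x hx]) (hsub'.const_sub_super _) hv (by simpa using hΛ) hconst z
    (ball_subset_closedBall (by convert hz using 2; ring))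
  have : K * (L + η + ρ - u z) ≤ K * (2 * ρ) := by gcongr; linarith
  linarith

theorem exists_tendsto_cobounded (μ : Measure E) [μ.IsAddHaarMeasure] {p C R₀ : ℝ} {u : E → ℝ}
    (hp : 1 < p) (hC : 0 ≤ C) (hE : 2 ≤ Module.finrank ℝ E) (hR₀ : 0 < R₀)
    (hu : ContDiffOn ℝ 1 u {x | R₀ < ‖x‖}) (hpos : ∀ x, R₀ < ‖x‖ → 0 < u x)
    (hsub : HalfSol μ p 1 0 {x | R₀ < ‖x‖} u)
    (hsup : ∀ a, R₀ ≤ a → HalfSol μ p (-1) (C / a ^ p) {x | a < ‖x‖} u) :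
    ∃ l : ℝ≥0∞, Tendsto (fun x => ENNReal.ofReal (u x)) (Bornology.cobounded E) (𝓝 l) := by
  have hev : ∀ a : ℝ, ∀ᶠ x : E in Bornology.cobounded E, a ≤ ‖x‖ :=
    fun a => tendsto_norm_cobounded_atTop.eventually_ge_atTop a
  have hdich := hsub.exists_sphere_or_bounded hp hR₀ hu
  set A := {c : ℝ | ∃ a, ∀ x, a ≤ ‖x‖ → u x ≤ c} with hA
  rcases A.eq_empty_or_nonempty with hA0 | hA0
  · refine ⟨⊤, ENNReal.tendsto_ofReal_atTop.comp (tendsto_atTop.2 fun b => ?_)⟩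
    obtain ⟨K, hK, harn⟩ := exists_harnack_sphere μ hp hC hE hR₀ hu hpos hsub hsup
    obtain ⟨a, ha⟩ := (hdich (K * b)).resolve_right fun h => (hA0 ▸ h : K * b ∈ (∅ : Set ℝ))
    filter_upwards [hev a, hev (2 * R₀)] with y hy1 hy2
    obtain ⟨x, hx, hxb⟩ := ha ‖y‖ hy1
    exact le_of_mul_le_mul_left (hxb.trans (harn _ hy2 x y hx rfl)) hK
  · obtain ⟨e, he, -⟩ := exists_unit_orthogonal hE (0 : E)
    have hA1 : ∀ c ∈ A, 0 ≤ c := by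
      rintro c ⟨a, ha⟩
      have h1 : ‖(max a (R₀ + 1)) • e‖ = max a (R₀ + 1) := by
        rw [norm_smul, he, mul_one, Real.norm_of_nonneg (le_max_of_le_right (by linarith))]
      have h2 := ha (max a (R₀ + 1) • e) (by rw [h1]; exact le_max_left _ _)
      have h3 := hpos (max a (R₀ + 1) • e) (by
        rw [h1]; exact lt_of_lt_of_le (by linarith) (le_max_right _ _))
      linarith
    set L := sInf A
    have hupper : ∀ η > 0, ∃ a, ∀ x, a ≤ ‖x‖ → u x < L + η := fun η hη => by
      obtain ⟨c, ⟨a, ha⟩, hc⟩ := exists_lt_of_csInf_lt hA0 (by linarith : sInf A < L + η)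
      exact ⟨a, fun x hx => (ha x hx).trans_lt hc⟩
    have hlower : ∀ η > 0, ∃ a, ∀ r, a ≤ r → ∃ x, ‖x‖ = r ∧ L - η ≤ u x := fun η hη =>
      (hdich (L - η)).resolve_right fun h =>
        absurd (csInf_le ⟨0, hA1⟩ h) (by linarith)
    refine ⟨ENNReal.ofReal L, (ENNReal.continuous_ofReal.tendsto L).comp ?_⟩
    refine Metric.tendsto_nhds.2 fun τ hτ => ?_
    obtain ⟨a₁, h1⟩ := hupper τ hτ
    obtain ⟨a₂, h2⟩ := eventually_le_of_limsup μ hp hC hE hR₀ (Real.sInf_nonneg hA1) hu hpos hsub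
      hsup hupper hlower (half_pos hτ)
    filter_upwards [hev a₁, hev a₂] with x hx1 hx2
    rw [Real.dist_eq, abs_lt]
    constructor <;> linarith [h1 x hx1, h2 x hx2]

end Exterior

section WeakSolution

variable {d : ℕ} {p M : ℝ} {V u : EuclideanSpace ℝ (Fin d) → ℝ}
  {Ω : Set (EuclideanSpace ℝ (Fin d))}

/-- Testing the equation against a smooth function, with the two terms separated. -/
lemma IsPosWeakSol.integral_flux (hp : 1 < p) (hΩ : IsOpen Ω) (hV : Measurable V)
    (hVM : ∀ᵐ x ∂(volume.restrict Ω), 0 ≤ V x ∧ V x ≤ M) (hu : IsPosWeakSol p V Ω u)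
    {φ : EuclideanSpace ℝ (Fin d) → ℝ} (hφ : ContDiff ℝ (⊤ : ℕ∞) φ) (hc : HasCompactSupport φ)
    (hs : tsupport φ ⊆ Ω) :
    IntegrableOn (fun x => V x * (u x ^ (p - 1) * φ x)) Ω ∧
    ∫ x, ‖gradient u x‖ ^ (p - 2) * ⟪gradient u x, gradient φ x⟫ =
      -∫ x in Ω, V x * (u x ^ (p - 1) * φ x) := by
  obtain ⟨hu1, hpos, hweak⟩ := hu
  have hφ1 : ContDiff ℝ 1 φ := hφ.of_le (by simp)
  have hflux := integrable_flux (μ := volume) hp hΩ hu1 hφ1 hc subset_rfl hs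
  have hg := integrable_rpow_mul (μ := volume) (q := p - 1) hu1.continuousOn hpos hφ.continuous hc hs
  have hVg : IntegrableOn (fun x => V x * (u x ^ (p - 1) * φ x)) Ω :=
    hg.integrableOn.bdd_mul (c := M) hV.aestronglyMeasurable <| by
      filter_upwards [hVM] with x hx
      rw [Real.norm_of_nonneg hx.1]
      exact hx.2
  refine ⟨hVg, ?_⟩
  have h := hweak φ hφ hc hs
  have e : ∫ x in Ω, (‖gradient u x‖ ^ (p - 2) * ⟪gradient u x, gradient φ x⟫ +
      V x * |u x| ^ (p - 2) * u x * φ x) =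
      ∫ x in Ω, (‖gradient u x‖ ^ (p - 2) * ⟪gradient u x, gradient φ x⟫ +
      V x * (u x ^ (p - 1) * φ x)) := by
    refine setIntegral_congr_fun hΩ.measurableSet fun x hx => ?_
    rw [abs_of_pos (hpos x hx), ← rpow_sub_two_mul_self hp (hpos x hx).le]
    ring
  rw [e, integral_add hflux.integrableOn hVg,
    setIntegral_eq_integral_of_forall_compl_eq_zero fun x hx => by
      simp [gradient_of_notMem_tsupport fun h => hx (hs h)]] at h
  linarith

lemma IsPosWeakSol.halfSol_sub (hp : 1 < p) (hΩ : IsOpen Ω) (hV : Measurable V)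
    (hVM : ∀ᵐ x ∂(volume.restrict Ω), 0 ≤ V x ∧ V x ≤ M) (hu : IsPosWeakSol p V Ω u) :
    HalfSol volume p 1 0 Ω u := by
  refine halfSol_of_smooth hp hΩ hu.1 hu.2.1 fun φ hφ hc hs h0 => ?_
  rw [one_mul, zero_mul, (hu.integral_flux hp hΩ hV hVM hφ hc hs).2, neg_nonpos]
  refine integral_nonneg_of_ae ?_
  filter_upwards [hVM, ae_restrict_mem hΩ.measurableSet] with x hx hxΩ
  exact mul_nonneg hx.1 (mul_nonneg (Real.rpow_nonneg (hu.2.1 x hxΩ).le _) (h0 x))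

lemma IsPosWeakSol.halfSol_super {U : Set (EuclideanSpace ℝ (Fin d))} {Λ : ℝ} (hp : 1 < p)
    (hΩ : IsOpen Ω) (hV : Measurable V) (hVM : ∀ᵐ x ∂(volume.restrict Ω), 0 ≤ V x ∧ V x ≤ M)
    (hu : IsPosWeakSol p V Ω u) (hU : IsOpen U) (hUΩ : U ⊆ Ω)
    (hVΛ : ∀ᵐ x ∂(volume.restrict Ω), x ∈ U → V x ≤ Λ) :
    HalfSol volume p (-1) Λ U u := by
  refine halfSol_of_smooth hp hU (hu.1.mono hUΩ) (fun x hx => hu.2.1 x (hUΩ hx))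
    fun φ hφ hc hs h0 => ?_
  obtain ⟨hint, heq⟩ := hu.integral_flux hp hΩ hV hVM hφ hc (hs.trans hUΩ)
  have hg := integrable_rpow_mul (μ := volume) (q := p - 1) hu.1.continuousOn hu.2.1 hφ.continuous
    hc (hs.trans hUΩ)
  rw [heq, neg_mul_neg, one_mul, ← integral_const_mul,
    ← setIntegral_eq_integral_of_forall_compl_eq_zero (s := Ω)
      (f := fun x => Λ * (u x ^ (p - 1) * φ x)) fun x hx => by
      simp [image_eq_zero_of_notMem_tsupport fun h => hx (hUΩ (hs h))]]
  refine integral_mono_ae hint (hg.const_mul Λ).integrableOn ?_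
  filter_upwards [hVΛ, ae_restrict_mem hΩ.measurableSet] with x hx hxΩ
  by_cases hxU : x ∈ U
  · exact mul_le_mul_of_nonneg_right (hx hxU)
      (mul_nonneg (Real.rpow_nonneg (hu.2.1 x hxΩ).le _) (h0 x))
  · simp [image_eq_zero_of_notMem_tsupport fun h => hxU (hs h)]

end WeakSolution

theorem stmt18 (d : ℕ) (hd : 2 ≤ d) (p : ℝ) (hp : 1 < p) (C : ℝ) (hC : 0 < C)
    (R₀ : ℝ) (hR₀ : 0 < R₀)
    (V : EuclideanSpace ℝ (Fin d) → ℝ) (hVmeas : Measurable V)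
    -- V is nonnegative and Fuchsian at infinity
    (hFuchs : ∀ᵐ x ∂(volume.restrict {x : EuclideanSpace ℝ (Fin d) | R₀ < ‖x‖}),
      0 ≤ V x ∧ ‖x‖ ^ p * V x ≤ C)
    -- every limiting dilated potential vanishes: scaled potentials tend weakly* to 
    (hdil : ∀ a b : ℝ, 0 < a → a < b →
      ∀ φ : EuclideanSpace ℝ (Fin d) → ℝ, Measurable φ → (∃ M : ℝ, ∀ x, |φ x| ≤ M) →
        (∀ x : EuclideanSpace ℝ (Fin d), ¬(a ≤ ‖x‖ ∧ ‖x‖ ≤ b) → φ x = 0) →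
        Tendsto
          (fun R : ℝ =>
            ∫ x in {x : EuclideanSpace ℝ (Fin d) | R₀ < ‖R • x‖}, R ^ p * V (R • x) * φ x)
          atTop (𝓝 0))
    (u : EuclideanSpace ℝ (Fin d) → ℝ)
    (hu : IsPosWeakSol p V {x : EuclideanSpace ℝ (Fin d) | R₀ < ‖x‖} u) :
    ∃ l : ℝ≥0∞, Tendsto (fun x => ENNReal.ofReal (u x))
      (Bornology.cobounded (EuclideanSpace ℝ (Fin d))) (𝓝 l) := by
  have hΩ : IsOpen {x : EuclideanSpace ℝ (Fin d) | R₀ < ‖x‖} := isOpen_setOf_lt_norm R₀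
  have hbound : ∀ a, R₀ ≤ a → ∀ᵐ x ∂(volume.restrict {x : EuclideanSpace ℝ (Fin d) | R₀ < ‖x‖}),
      x ∈ {x : EuclideanSpace ℝ (Fin d) | a < ‖x‖} → V x ≤ C / a ^ p := fun a ha => by
    filter_upwards [hFuchs] with x hx (hxa : a < ‖x‖)
    have ha0 : 0 < a := hR₀.trans_le ha
    rw [le_div_iff₀ (by positivity), mul_comm]
    refine le_trans (mul_le_mul_of_nonneg_right ?_ hx.1) hx.2
    exact Real.rpow_le_rpow ha0.le hxa.le (by linarith)
  have hVM : ∀ᵐ x ∂(volume.restrict {x : EuclideanSpace ℝ (Fin d) | R₀ < ‖x‖}),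
      0 ≤ V x ∧ V x ≤ C / R₀ ^ p := by
    filter_upwards [hFuchs, hbound R₀ le_rfl, ae_restrict_mem hΩ.measurableSet] with x h1 h2 h3
    exact ⟨h1.1, h2 h3⟩
  exact exists_tendsto_cobounded volume hp hC.le (by simpa using hd) hR₀ hu.1 hu.2.1
    (hu.halfSol_sub hp hΩ hVmeas hVM) fun a ha => hu.halfSol_super hp hΩ hVmeas hVM
      (isOpen_setOf_lt_norm a) (fun x (hx : a < ‖x‖) => show R₀ < ‖x‖ from ha.trans_lt hx) (hbound a ha)
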